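/- For every function r : {0,…,2k} → ℚ with Σ_{i=0}^{2k} r_i = 0, there exists a finite set S of triples (a,b,c) with 0 ≤ a,b,c ≤ 2k and a ≠ b such that the family {f₂((x_a∧x_b)⊗x_c) : (a,b,c) ∈ S} is a basis of ker f₁ and Σ_{(a,b,c)∈S} (r_a + r_b + r_c) ≥ 0. (This is the Hilbert–Mumford numerical-criterion content of the semi-stability of the 1st syzygy point of the genus-g balanced ribbon with respect to the maximal torus acting diagonally on x_0,…,x_{2k}.) -/

import Mathlib

set_option synthInstance.maxHeartbeats 400000
set_option maxHeartbeats 1000000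

noncomputable section

open scoped TensorProduct

/-- The coordinate ring `A = ℂ[u,ε]/(ε²)` of the chart `U` of the balanced ribbon. -/
def A : Type := DualNumber (Polynomial ℂ)

instance : CommRing A := inferInstanceAs (CommRing (DualNumber (Polynomial ℂ)))
instance : Algebra ℂ A := inferInstanceAs (Algebra ℂ (DualNumber (Polynomial ℂ)))

def uu : A := TrivSqZeroExt.inl Polynomial.X
def ee : A := DualNumber.eps

/-- The restrictions to `U` of the standard basis of `H⁰(ω)` of the balanced ribbon. -/
def x (k i : ℕ) : A :=
  if i ≤ k then uu ^ i else uu ^ i + ((i - k : ℕ) : A) * uu ^ (i - k - 1) * ee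

/-- `V_m`: the span of the degree-`m` monomials in `x_0, …, x_{2k}`. -/
def V (k m : ℕ) : Submodule ℂ A :=
  Submodule.span ℂ {a | ∃ f : Fin m → ℕ, (∀ j, f j ≤ 2 * k) ∧ a = ∏ j, x k (f j)}

/-- `W = span ℂ {x_0, …, x_{2k}}`. -/
def W (k : ℕ) : Submodule ℂ A := Submodule.span ℂ (x k '' Set.Iic (2 * k))

def xW (k i : ℕ) : ↥(W k) :=
  if h : i ≤ 2 * k then ⟨x k i, Submodule.subset_span ⟨i, h, rfl⟩⟩ else 0

def xV2 (k i j : ℕ) : ↥(V k 2) :=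
  if h : i ≤ 2 * k ∧ j ≤ 2 * k then
    ⟨x k i * x k j, Submodule.subset_span ⟨![i, j], by
      refine ⟨?_, ?_⟩
      · intro t
        fin_cases t
        · simpa using h.1
        · simpa using h.2
      · simp [Fin.prod_univ_two]⟩⟩
  else 0

/-- The Koszul differential `f₁ : W ⊗ V₂ → V₃ ⊆ A`, `x ⊗ q ↦ x·q`. -/
def f1 (k : ℕ) : (↥(W k) ⊗[ℂ] ↥(V k 2)) →ₗ[ℂ] A :=
  TensorProduct.lift (((LinearMap.mul ℂ A).comp (W k).subtype).compl₂ (V k 2).subtype)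

/-- The image under the Koszul differential `f₂` of the cosyzygy `(x_a ∧ x_b) ⊗ x_c`,
namely `x_b ⊗ x_a x_c − x_a ⊗ x_b x_c ∈ W ⊗ V₂`. -/
def cosz (k a b c : ℕ) : ↥(W k) ⊗[ℂ] ↥(V k 2) :=
  xW k b ⊗ₜ[ℂ] xV2 k a c - xW k a ⊗ₜ[ℂ] xV2 k b c

/-- A finite set `S` of triples is a monomial basis of cosyzygies if the family
`f₂((x_a ∧ x_b) ⊗ x_c) = x_b ⊗ x_a x_c − x_a ⊗ x_b x_c`, `(a,b,c) ∈ S`,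
is a basis of `ker f₁`. -/
def IsMonomialBasisOfCosyzygies (k : ℕ) (S : Finset (ℕ × ℕ × ℕ)) : Prop :=
  LinearIndependent ℂ (fun t : S => cosz k t.1.1 t.1.2.1 t.1.2.2) ∧
  Submodule.span ℂ ((fun t : ℕ × ℕ × ℕ => cosz k t.1 t.2.1 t.2.2) '' ↑S) =
    LinearMap.ker (f1 k)

/-- The number of occurrences of the index `i` among the entries of the triples of `S`. -/
def occ (S : Finset (ℕ × ℕ × ℕ)) (i : ℕ) : ℕ :=
  ∑ t ∈ S, ((if t.1 = i then 1 else 0) + (if t.2.1 = i then 1 else 0) +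
    (if t.2.2 = i then 1 else 0))


/-- The coefficient of `u ^ n` of an element of `A`. -/
def coeffU (n : ℕ) : A →ₗ[ℂ] ℂ where
  toFun a := (TrivSqZeroExt.fst (show DualNumber (Polynomial ℂ) from a)).coeff n
  map_add' _ _ := Polynomial.coeff_add _ _ n
  map_smul' c _ := Polynomial.coeff_smul c _ n

/-- The coefficient of `u ^ n * ε` of an element of `A`. -/
def coeffE (n : ℕ) : A →ₗ[ℂ] ℂ where
  toFun a := (TrivSqZeroExt.snd (show DualNumber (Polynomial ℂ) from a)).coeff n
  map_add' _ _ := Polynomial.coeff_add _ _ n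
  map_smul' c _ := Polynomial.coeff_smul c _ n

lemma uu_pow (n : ℕ) : uu ^ n =
    (show A from (TrivSqZeroExt.inl (Polynomial.X ^ n) : DualNumber (Polynomial ℂ))) := by
  have h : ((TrivSqZeroExt.inl Polynomial.X : DualNumber (Polynomial ℂ)) ^ n) =
    TrivSqZeroExt.inl (Polynomial.X ^ n) := TrivSqZeroExt.inl_pow _ _
  exact h

lemma uu_pow_mul_ee (n : ℕ) : uu ^ n * ee =
    (show A from (TrivSqZeroExt.inr (Polynomial.X ^ n) : DualNumber (Polynomial ℂ))) := by
  rw [uu_pow]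
  have h : (TrivSqZeroExt.inl (Polynomial.X ^ n) : DualNumber (Polynomial ℂ)) * DualNumber.eps =
    TrivSqZeroExt.inr (Polynomial.X ^ n) := by
    rw [DualNumber.eps, TrivSqZeroExt.inl_mul_inr, smul_eq_mul, mul_one]
  exact h

lemma ee_mul_ee : ee * ee = 0 :=
  (DualNumber.eps_mul_eps : (DualNumber.eps : DualNumber (Polynomial ℂ)) * DualNumber.eps = 0)

lemma coeffU_uu (n m : ℕ) : coeffU n (uu ^ m) = if n = m then 1 else 0 := by
  rw [uu_pow]
  exact Polynomial.coeff_X_pow m n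

lemma coeffE_uu (n m : ℕ) : coeffE n (uu ^ m) = 0 := by
  rw [uu_pow]
  exact Polynomial.coeff_zero n

lemma coeffU_ee (n m : ℕ) : coeffU n (uu ^ m * ee) = 0 := by
  rw [uu_pow_mul_ee]
  exact Polynomial.coeff_zero n

lemma coeffE_ee (n m : ℕ) : coeffE n (uu ^ m * ee) = if n = m then 1 else 0 := by
  rw [uu_pow_mul_ee]
  exact Polynomial.coeff_X_pow m n

/-- The element `u ^ n + c u ^ (n - k - 1) ε` of `A`. -/
def mono (k n c : ℕ) : A := uu ^ n + (c : ℂ) • (uu ^ (n - k - 1) * ee)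

lemma x_eq (k i : ℕ) : x k i = mono k i (i - k) := by
  unfold x mono
  split_ifs with h
  · simp [Nat.sub_eq_zero_of_le h]
  · rw [Algebra.smul_def, map_natCast, mul_assoc]

lemma mono_mul (k m n c e : ℕ) (hc : c ≠ 0 → k + 1 ≤ m) (he : e ≠ 0 → k + 1 ≤ n) :
    mono k m c * mono k n e = mono k (m + n) (c + e) := by
  unfold mono
  have h : ∀ (a b : A) (s t : ℂ) (v w z : A), s • (v * b) = s • z → t • (a * w) = t • z →
      (a + s • (v * ee)) * (b + t • (w * ee)) = a * b + (s + t) • (z * ee) := by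
    intro a b s t v w z h1 h2
    simp only [Algebra.smul_def] at *
    rw [map_add]
    linear_combination ee * h1 + ee * h2 + (algebraMap ℂ A s * algebraMap ℂ A t * v * w) * ee_mul_ee
  rw [h _ _ _ _ _ _ (uu ^ (m + n - k - 1)), pow_add, Nat.cast_add]
  · rcases eq_or_ne c 0 with rfl | h0
    · simp
    · rw [← pow_add]; congr 2; have := hc h0; omega
  · rcases eq_or_ne e 0 with rfl | h0
    · simp
    · rw [← pow_add]; congr 2; have := he h0; omega

lemma x_mul_x (k i j : ℕ) : x k i * x k j = mono k (i + j) ((i - k) + (j - k)) := by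
  rw [x_eq, x_eq, mono_mul] <;> omega

lemma x_mul_x_mul_x (k i j l : ℕ) :
    x k i * (x k j * x k l) = mono k (i + (j + l)) ((i - k) + ((j - k) + (l - k))) := by
  rw [x_mul_x, x_eq, mono_mul] <;> omega

lemma coeffU_mono (k n m c : ℕ) : coeffU n (mono k m c) = if n = m then 1 else 0 := by
  simp [mono, coeffU_uu, coeffU_ee]

lemma coe_xW (k i : ℕ) (hi : i ≤ 2 * k) : (xW k i : A) = x k i := by simp [xW, hi]

lemma coe_xV2 (k i j : ℕ) (hi : i ≤ 2 * k) (hj : j ≤ 2 * k) :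
    (xV2 k i j : A) = x k i * x k j := by simp [xV2, hi, hj]

lemma f1_tmul (k : ℕ) (w : W k) (v : V k 2) : f1 k (w ⊗ₜ[ℂ] v) = (w : A) * (v : A) := rfl

lemma V_two_eq (k : ℕ) :
    V k 2 = Submodule.span ℂ {a | ∃ i j, i ≤ 2 * k ∧ j ≤ 2 * k ∧ a = x k i * x k j} := by
  unfold V
  congr 1
  ext a
  constructor
  · rintro ⟨f, hf, rfl⟩
    exact ⟨f 0, f 1, hf 0, hf 1, Fin.prod_univ_two _⟩
  · rintro ⟨i, j, hi, hj, rfl⟩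
    refine ⟨![i, j], fun t => ?_, ?_⟩
    · fin_cases t <;> simpa
    · simp [Fin.prod_univ_two]

/-- A linear map on `W ⊗ V₂` is determined by its values on the monomial tensors. -/
lemma tensor_hom_ext (k : ℕ) {φ ψ : (↥(W k) ⊗[ℂ] ↥(V k 2)) →ₗ[ℂ] ℂ}
    (h : ∀ a b c, a ≤ 2 * k → b ≤ 2 * k → c ≤ 2 * k →
      φ (xW k a ⊗ₜ[ℂ] xV2 k b c) = ψ (xW k a ⊗ₜ[ℂ] xV2 k b c)) : φ = ψ := by
  apply TensorProduct.ext'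
  rintro ⟨w, hw⟩ ⟨v, hv⟩
  have hv' : v ∈ Submodule.span ℂ {a | ∃ i j, i ≤ 2 * k ∧ j ≤ 2 * k ∧ a = x k i * x k j} := by
    rwa [← V_two_eq]
  have hV : ∀ v ∈ Submodule.span ℂ {a | ∃ i j, i ≤ 2 * k ∧ j ≤ 2 * k ∧ a = x k i * x k j},
      v ∈ V k 2 := fun v hv => by rwa [V_two_eq]
  revert hv
  induction hv' using Submodule.span_induction with
  | zero => intro hv; rw [show (⟨0, hv⟩ : V k 2) = 0 from rfl]; simp
  | add y z hy hz iy iz =>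
    intro hv
    rw [show (⟨y + z, hv⟩ : V k 2) = ⟨y, hV y hy⟩ + ⟨z, hV z hz⟩ from rfl, TensorProduct.tmul_add,
      map_add, map_add, iy, iz]
  | smul c y hy iy =>
    intro hv
    rw [show (⟨c • y, hv⟩ : V k 2) = c • ⟨y, hV y hy⟩ from rfl, TensorProduct.tmul_smul,
      map_smul, map_smul, iy]
  | mem y hy =>
    obtain ⟨i, j, hi, hj, rfl⟩ := hy
    intro hv
    rw [show (⟨x k i * x k j, hv⟩ : V k 2) = xV2 k i j from
      Subtype.ext (coe_xV2 k i j hi hj).symm]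
    have hw' : w ∈ Submodule.span ℂ (x k '' Set.Iic (2 * k)) := hw
    have hW : ∀ w ∈ Submodule.span ℂ (x k '' Set.Iic (2 * k)), w ∈ W k := fun w hw => hw
    revert hw
    induction hw' using Submodule.span_induction with
    | zero => intro hw; rw [show (⟨0, hw⟩ : W k) = 0 from rfl]; simp
    | add y z hy hz iy iz =>
      intro hw
      rw [show (⟨y + z, hw⟩ : W k) = ⟨y, hW y hy⟩ + ⟨z, hW z hz⟩ from rfl,
        TensorProduct.add_tmul, map_add, map_add, iy, iz]
    | smul c y hy iy =>
      intro hw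
      rw [show (⟨c • y, hw⟩ : W k) = c • ⟨y, hW y hy⟩ from rfl,
        ← TensorProduct.smul_tmul', map_smul, map_smul, iy]
    | mem y hy =>
      obtain ⟨a, ha, rfl⟩ := hy
      intro hw
      rw [show (⟨x k a, hw⟩ : W k) = xW k a from Subtype.ext (coe_xW k a ha).symm]
      exact h a i j ha hi hj

lemma finrank_W (k : ℕ) : 2 * k + 1 ≤ Module.finrank ℂ (W k) := by
  have hfd : FiniteDimensional ℂ (W k) :=
    FiniteDimensional.span_of_finite ℂ ((Set.finite_Iic _).image _)
  have hli : LinearIndependent ℂ (fun i : Fin (2 * k + 1) => xW k i) := by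
    rw [Fintype.linearIndependent_iff]
    intro g hg j
    have h := congrArg (fun w : W k => coeffU j (w : A)) hg
    simp only [AddSubmonoidClass.coe_finsetSum, SetLike.val_smul, map_sum, map_smul,
      ZeroMemClass.coe_zero, map_zero] at h
    rw [Finset.sum_eq_single j] at h
    · rw [coe_xW _ _ (by omega), x_eq, coeffU_mono] at h
      simpa using h
    · intro b _ hb
      rw [coe_xW _ _ (by omega), x_eq, coeffU_mono, if_neg, smul_zero]
      exact fun hh => hb (Fin.ext hh.symm)
    · simp
  simpa using hli.fintype_card_le_finrank

lemma finiteDimensional_V_two (k : ℕ) : FiniteDimensional ℂ (V k 2) := by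
  rw [V_two_eq]
  apply FiniteDimensional.span_of_finite
  refine (((Set.finite_Iic (2 * k)).prod (Set.finite_Iic (2 * k))).image
    (fun p : ℕ × ℕ => x k p.1 * x k p.2)).subset ?_
  rintro _ ⟨i, j, hi, hj, rfl⟩
  exact ⟨(i, j), ⟨hi, hj⟩, rfl⟩

lemma x_mul_x_mem (k i j : ℕ) (hi : i ≤ 2 * k) (hj : j ≤ 2 * k) : x k i * x k j ∈ V k 2 := by
  rw [V_two_eq]
  exact Submodule.subset_span ⟨i, j, hi, hj, rfl⟩

lemma mono_sub_mono (k n c e : ℕ) :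
    mono k n c - mono k n e = ((c : ℂ) - e) • (uu ^ (n - k - 1) * ee) := by
  unfold mono
  rw [sub_smul]
  abel

lemma eps_mem (k j : ℕ) (hj : j + 1 < 2 * k) : uu ^ j * ee ∈ V k 2 := by
  have key : ∀ a b c d : ℕ, a ≤ 2 * k → b ≤ 2 * k → c ≤ 2 * k → d ≤ 2 * k →
      a + b = j + k + 1 → c + d = j + k + 1 → (a - k) + (b - k) ≠ (c - k) + (d - k) →
      uu ^ j * ee ∈ V k 2 := by
    intro a b c d ha hb hc hd h1 h2 hne
    have h := Submodule.sub_mem _ (x_mul_x_mem k a b ha hb) (x_mul_x_mem k c d hc hd)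
    rw [x_mul_x, x_mul_x, h1, h2, mono_sub_mono] at h
    have e : j + k + 1 - k - 1 = j := by omega
    rw [e] at h
    refine (Submodule.smul_mem_iff _ ?_).1 h
    rw [sub_ne_zero]
    exact_mod_cast hne
  by_cases h : j + k + 1 ≤ 2 * k
  · exact key 0 (j + k + 1) (j + 1) k (by omega) (by omega) (by omega) (by omega) (by omega)
      (by omega) (by omega)
  · exact key (2 * k) (j + k + 1 - 2 * k) k (j + 1) (by omega) (by omega) (by omega) (by omega)
      (by omega) (by omega) (by omega)

lemma finrank_V_two (k : ℕ) (hk : 1 ≤ k) : 6 * k ≤ Module.finrank ℂ (V k 2) := by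
  have hfd := finiteDimensional_V_two k
  let v : Fin (4 * k + 1) ⊕ Fin (2 * k - 1) → V k 2 := Sum.elim
    (fun i => xV2 k (min (i : ℕ) (2 * k)) ((i : ℕ) - min (i : ℕ) (2 * k)))
    (fun j => ⟨uu ^ (j : ℕ) * ee, eps_mem k j (by omega)⟩)
  have hv : ∀ i : Fin (4 * k + 1), ∃ c, (v (.inl i) : A) = mono k i c := by
    intro i
    refine ⟨(min (i : ℕ) (2 * k) - k) + ((i : ℕ) - min (i : ℕ) (2 * k) - k), ?_⟩
    simp only [v, Sum.elim_inl]
    rw [coe_xV2 _ _ _ (by omega) (by omega), x_mul_x]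
    congr 1
    omega
  have hw : ∀ j : Fin (2 * k - 1), (v (.inr j) : A) = uu ^ (j : ℕ) * ee := fun j => rfl
  have hli : LinearIndependent ℂ v := by
    rw [Fintype.linearIndependent_iff]
    intro g hg
    rw [Fintype.sum_sum_type] at hg
    have hg' := congrArg (fun w : V k 2 => (w : A)) hg
    simp only [AddSubmonoidClass.coe_finsetSum, SetLike.val_smul, Submodule.coe_add,
      ZeroMemClass.coe_zero, hw] at hg'
    have h1 : ∀ i, g (.inl i) = 0 := by
      intro j
      have h := congrArg (coeffU j) hg'
      simp only [map_add, map_sum, map_smul, coeffU_ee, smul_zero, Finset.sum_const_zero,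
        add_zero, map_zero] at h
      rw [Finset.sum_eq_single j] at h
      · obtain ⟨c, hc⟩ := hv j
        rw [hc, coeffU_mono] at h
        simpa using h
      · intro b _ hb
        obtain ⟨c, hc⟩ := hv b
        rw [hc, coeffU_mono, if_neg, smul_zero]
        exact fun hh => hb (Fin.ext hh.symm)
      · simp
    rintro (i | j)
    · exact h1 i
    · have h := congrArg (coeffE j) hg'
      simp only [h1, map_sum, map_smul, coeffE_ee, zero_smul, Finset.sum_const_zero,
        zero_add, map_zero] at h
      rw [Finset.sum_eq_single j] at h
      · simpa using h
      · intro b _ hb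
        rw [if_neg, smul_zero]
        exact fun hh => hb (Fin.ext hh.symm)
      · simp
  have h := hli.fintype_card_le_finrank
  simp only [Fintype.card_sum, Fintype.card_fin] at h
  omega

/-- A spanning family of the range of `f₁`, of the size of `H⁰(ω³)`. -/
def cubicSpan (k : ℕ) : Fin (5 * k) ⊕ Fin (4 * k - 1) ⊕ Fin (k + 1) → A :=
  Sum.elim (fun i => uu ^ (i : ℕ)) (Sum.elim (fun j => uu ^ (j : ℕ) * ee)
    (fun l => mono k (l + 5 * k) (l + 2 * k)))

lemma finrank_range_f1 (k : ℕ) (hk : 1 ≤ k) :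
    Module.finrank ℂ (LinearMap.range (f1 k)) ≤ 10 * k := by
  have hsub : LinearMap.range (f1 k) ≤ Submodule.span ℂ (Set.range (cubicSpan k)) := by
    rintro _ ⟨t, rfl⟩
    by_contra hcon
    obtain ⟨φ, hφ, hφ0⟩ := Submodule.exists_le_ker_of_notMem hcon
    have h0 : φ ∘ₗ f1 k = 0 := by
      apply tensor_hom_ext
      intro a b c ha hb hc
      have hz : ∀ i, φ (cubicSpan k i) = 0 := fun i =>
        LinearMap.mem_ker.1 (hφ0 (Submodule.subset_span ⟨i, rfl⟩))
      rw [LinearMap.comp_apply, f1_tmul, coe_xW _ _ ha, coe_xV2 _ _ _ hb hc, x_mul_x_mul_x,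
        LinearMap.zero_apply]
      by_cases h5 : 5 * k ≤ a + (b + c)
      · have h := hz (.inr (.inr ⟨a + (b + c) - 5 * k, by omega⟩))
        simp only [cubicSpan, Sum.elim_inr] at h
        convert h using 2
        congr 1 <;> omega
      · have h := hz (.inl ⟨a + (b + c), by omega⟩)
        simp only [cubicSpan, Sum.elim_inl] at h
        rw [mono, map_add, h, zero_add, map_smul]
        rcases Nat.eq_zero_or_pos (a - k + (b - k + (c - k))) with h' | h'
        · rw [h', Nat.cast_zero, zero_smul]
        · have h := hz (.inr (.inl ⟨a + (b + c) - k - 1, by omega⟩))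
          simp only [cubicSpan, Sum.elim_inr, Sum.elim_inl] at h
          rw [h, smul_zero]
    exact hφ (by rw [← LinearMap.comp_apply, h0, LinearMap.zero_apply])
  have hfd : FiniteDimensional ℂ (Submodule.span ℂ (Set.range (cubicSpan k))) :=
    FiniteDimensional.span_of_finite ℂ (Set.finite_range _)
  have h1 := Submodule.finrank_mono hsub
  have h2 := finrank_range_le_card (R := ℂ) (cubicSpan k)
  simp only [Set.finrank, Fintype.card_sum, Fintype.card_fin] at h2
  omega

lemma finrank_ker_f1 (k : ℕ) (hk : 1 ≤ k) :
    12 * k ^ 2 - 4 * k ≤ Module.finrank ℂ (LinearMap.ker (f1 k)) := by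
  have hfd := finiteDimensional_V_two k
  have hfd' : FiniteDimensional ℂ (W k) :=
    FiniteDimensional.span_of_finite ℂ ((Set.finite_Iic _).image _)
  have h := LinearMap.finrank_range_add_finrank_ker (K := ℂ) (V := ↥(W k) ⊗[ℂ] ↥(V k 2)) (V₂ := A) (f1 k)
  rw [Module.finrank_tensorProduct] at h
  have h1 := Nat.mul_le_mul (finrank_W k) (finrank_V_two k hk)
  have h2 := finrank_range_f1 k hk
  have h3 : (2 * k + 1) * (6 * k) = 12 * k ^ 2 + 6 * k := by ring
  omega

/-- The sum of the absolute values of the entries of a triple of centered indices. -/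
def label (a b c : ℤ) : ℤ := |a| + |b| + |c|

/-- A set of (centered) cosyzygies is rigid in degree `d` if affine functions `s ↦ p b + q b * s`
attached to the indices that agree along its edges of degree `d` come from a single one. -/
def Rigid (k d : ℤ) (S : Set (ℤ × ℤ × ℤ)) : Prop :=
  ∀ p q : ℤ → ℝ,
    (∀ a b c, (a, b, c) ∈ S → a + b + c = d →
      p a + q a * label a b c = p b + q b * label a b c) →
    ∃ P Q : ℝ, ∀ a b c, |a| ≤ k → |b| ≤ k → |c| ≤ k → a + b + c = d →
      p a + q a * label a b c = P + Q * label a b c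

/-- The cosyzygy with a triple of centered indices. -/
def coszInt (k : ℕ) (t : ℤ × ℤ × ℤ) : ↥(W k) ⊗[ℂ] ↥(V k 2) :=
  cosz k (t.1 + k).toNat (t.2.1 + k).toNat (t.2.2 + k).toNat

lemma Rigid.complex {k d : ℤ} {S : Set (ℤ × ℤ × ℤ)} (hS : Rigid k d S) (p q : ℤ → ℂ)
    (h : ∀ a b c, (a, b, c) ∈ S → a + b + c = d →
      p a + q a * label a b c = p b + q b * label a b c) :
    ∃ P Q : ℂ, ∀ a b c, |a| ≤ k → |b| ≤ k → |c| ≤ k → a + b + c = d →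
      p a + q a * label a b c = P + Q * label a b c := by
  obtain ⟨P, Q, h1⟩ := hS (fun i => (p i).re) (fun i => (q i).re) (by
    intro a b c hm hd
    simpa using congrArg Complex.re (h a b c hm hd))
  obtain ⟨P', Q', h2⟩ := hS (fun i => (p i).im) (fun i => (q i).im) (by
    intro a b c hm hd
    simpa using congrArg Complex.im (h a b c hm hd))
  refine ⟨⟨P, P'⟩, ⟨Q, Q'⟩, fun a b c ha hb hc hd => ?_⟩
  apply Complex.ext
  · simpa using h1 a b c ha hb hc hd
  · simpa using h2 a b c ha hb hc hd

lemma exists_affine (k : ℕ) (φ : (↥(W k) ⊗[ℂ] ↥(V k 2)) →ₗ[ℂ] ℂ) :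
    ∃ α β : ℕ → ℕ → ℂ, ∀ a b c, a ≤ 2 * k → b ≤ 2 * k → c ≤ 2 * k →
      φ (xW k a ⊗ₜ[ℂ] xV2 k b c) =
        α a (b + c) + β a (b + c) * (((b - k) + (c - k) : ℕ) : ℂ) := by
  have h : ∀ a, ∃ g : A →ₗ[ℂ] ℂ, g ∘ₗ (V k 2).subtype =
      φ ∘ₗ TensorProduct.mk ℂ (W k) (V k 2) (xW k a) := fun a => LinearMap.exists_extend _
  choose g hg using h
  refine ⟨fun a n => g a (uu ^ n), fun a n => g a (uu ^ (n - k - 1) * ee),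
    fun a b c ha hb hc => ?_⟩
  have h1 := LinearMap.congr_fun (hg a) (xV2 k b c)
  simp only [LinearMap.comp_apply, Submodule.subtype_apply, TensorProduct.mk_apply] at h1
  rw [← h1, coe_xV2 _ _ _ hb hc, x_mul_x, mono, map_add, map_smul, smul_eq_mul, mul_comm]

lemma cast_sub_eq (k n : ℕ) : ((n - k : ℕ) : ℂ) = (((n : ℤ) - k + |(n : ℤ) - k| : ℤ) : ℂ) / 2 := by
  rcases le_total n k with h | h
  · rw [Nat.sub_eq_zero_of_le h, abs_of_nonpos (by omega)]
    simp
  · rw [abs_of_nonneg (by omega), Nat.cast_sub h]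
    push_cast
    ring

/-- A linear form killing rigid cosyzygies factors through `f₁`. -/
lemma exists_factor (k : ℕ) (S : Set (ℤ × ℤ × ℤ))
    (hS : ∀ t ∈ S, |t.1| ≤ k ∧ |t.2.1| ≤ k ∧ |t.2.2| ≤ k)
    (hrig : ∀ d, Rigid k d S) (φ : (↥(W k) ⊗[ℂ] ↥(V k 2)) →ₗ[ℂ] ℂ)
    (hφ : ∀ t ∈ S, φ (coszInt k t) = 0) : ∃ ψ : A →ₗ[ℂ] ℂ, φ = ψ ∘ₗ f1 k := by
  obtain ⟨α, β, hαβ⟩ := exists_affine k φ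
  have key : ∀ n : ℕ, ∃ P Q : ℂ, ∀ a b c, a ≤ 2 * k → b ≤ 2 * k → c ≤ 2 * k → a + (b + c) = n →
      φ (xW k a ⊗ₜ[ℂ] xV2 k b c) = P + Q * (((a - k) + ((b - k) + (c - k)) : ℕ) : ℂ) := by
    intro n
    let d : ℤ := n - 3 * k
    let N : ℤ → ℕ := fun i => (i + k).toNat
    let p : ℤ → ℂ := fun i => α (N i) (n - N i) +
      β (N i) (n - N i) * (d / 2 - ((N i - k : ℕ) : ℂ))
    let q : ℤ → ℂ := fun i => β (N i) (n - N i) / 2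
    have hval : ∀ a b c : ℤ, |a| ≤ k → |b| ≤ k → |c| ≤ k → a + b + c = d →
        φ (xW k (N a) ⊗ₜ[ℂ] xV2 k (N b) (N c)) = p a + q a * label a b c := by
      intro a b c ha hb hc hd
      rw [abs_le] at ha hb hc
      have hN : ∀ i, N i = (i + k).toNat := fun _ => rfl
      have e1 : ((N a : ℕ) : ℤ) = a + k := by rw [hN]; omega
      have e2 : ((N b : ℕ) : ℤ) = b + k := by rw [hN]; omega
      have e3 : ((N c : ℕ) : ℤ) = c + k := by rw [hN]; omega
      rw [hαβ _ _ _ (by omega) (by omega) (by omega)]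
      have e : N b + N c = n - N a := by omega
      rw [e]
      simp only [p, q]
      rw [Nat.cast_add, cast_sub_eq, cast_sub_eq, cast_sub_eq, e1, e2, e3, label,
        add_sub_cancel_right, add_sub_cancel_right, add_sub_cancel_right, ← hd]
      push_cast
      ring
    obtain ⟨P, Q, hPQ⟩ := (hrig d).complex p q (by
      intro a b c hm hd
      obtain ⟨ha, hb, hc⟩ := hS _ hm
      have h := hφ _ hm
      rw [coszInt, cosz, map_sub, sub_eq_zero] at h
      have h1 := hval b a c hb ha hc (by omega)
      have h2 := hval a b c ha hb hc hd
      rw [← h2, ← h, h1, label, label, add_comm |a|])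
    refine ⟨P + Q * (-d), Q * 2, fun a b c ha hb hc hn => ?_⟩
    have h1 := hPQ (a - k) (b - k) (c - k) (by rw [abs_le]; omega) (by rw [abs_le]; omega)
      (by rw [abs_le]; omega) (by omega)
    have h2 := hval (a - k) (b - k) (c - k) (by rw [abs_le]; omega) (by rw [abs_le]; omega)
      (by rw [abs_le]; omega) (by omega)
    simp only [N, sub_add_cancel, Int.toNat_natCast] at h2
    rw [h2, h1, Nat.cast_add, Nat.cast_add, cast_sub_eq, cast_sub_eq, cast_sub_eq, label]
    have e : d = (a - k) + (b - k) + (c - k) := by omega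
    rw [e]
    push_cast
    ring
  choose P Q hPQ using key
  refine ⟨∑ n ∈ Finset.range (6 * k + 1), (P n • coeffU n + Q (n + k + 1) • coeffE n), ?_⟩
  apply tensor_hom_ext
  intro a b c ha hb hc
  rw [hPQ _ a b c ha hb hc rfl, LinearMap.comp_apply, f1_tmul, coe_xW _ _ ha,
    coe_xV2 _ _ _ hb hc, x_mul_x_mul_x, LinearMap.sum_apply]
  simp only [mono, LinearMap.add_apply, LinearMap.smul_apply, map_add, map_smul, coeffU_uu,
    coeffU_ee, coeffE_uu, coeffE_ee, smul_eq_mul, mul_zero, add_zero, zero_add,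
    Finset.sum_add_distrib, mul_ite, mul_one, Finset.sum_ite_eq']
  rw [if_pos (by rw [Finset.mem_range]; omega), if_pos (by rw [Finset.mem_range]; omega)]
  rcases Nat.eq_zero_or_pos (a - k + (b - k + (c - k))) with h' | h'
  · simp [h']
  · have e : a + (b + c) - k - 1 + k + 1 = a + (b + c) := by omega
    rw [e]
    ring

/-- The weight of a triple. -/
def wt (R : ℤ → ℚ) (t : ℤ × ℤ × ℤ) : ℚ := R t.1 + R t.2.1 + R t.2.2

lemma f1_cosz (k a b c : ℕ) (ha : a ≤ 2 * k) (hb : b ≤ 2 * k) (hc : c ≤ 2 * k) :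
    f1 k (cosz k a b c) = 0 := by
  rw [cosz, map_sub, f1_tmul, f1_tmul, coe_xW _ _ ha, coe_xW _ _ hb, coe_xV2 _ _ _ ha hc,
    coe_xV2 _ _ _ hb hc]
  ring

/-- Rigid multisets of cosyzygies of the right cardinality give monomial bases. -/
lemma exists_basis (k : ℕ) (hk : 1 ≤ k) (M : Multiset (ℤ × ℤ × ℤ))
    (hM : ∀ t ∈ M, |t.1| ≤ k ∧ |t.2.1| ≤ k ∧ |t.2.2| ≤ k ∧ t.1 ≠ t.2.1)
    (hcard : (M.card : ℤ) = 12 * k ^ 2 - 4 * k)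
    (hrig : ∀ d, Rigid k d {t | t ∈ M}) (r : ℕ → ℚ)
    (hw : 0 ≤ (M.map (wt fun i => r (i + k).toNat)).sum) :
    ∃ S : Finset (ℕ × ℕ × ℕ),
      (∀ t ∈ S, t.1 ≤ 2 * k ∧ t.2.1 ≤ 2 * k ∧ t.2.2 ≤ 2 * k ∧ t.1 ≠ t.2.1) ∧
      IsMonomialBasisOfCosyzygies k S ∧
      0 ≤ ∑ t ∈ S, (r t.1 + r t.2.1 + r t.2.2) := by
  classical
  let σ : ℤ × ℤ × ℤ → ℕ × ℕ × ℕ :=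
    fun t => ((t.1 + k).toNat, (t.2.1 + k).toNat, (t.2.2 + k).toNat)
  have hM' : ∀ t ∈ M, -(k : ℤ) ≤ t.1 ∧ t.1 ≤ k ∧ -(k : ℤ) ≤ t.2.1 ∧ t.2.1 ≤ k ∧
      -(k : ℤ) ≤ t.2.2 ∧ t.2.2 ≤ k ∧ t.1 ≠ t.2.1 := by
    intro t ht
    have h := hM t ht
    simp only [abs_le] at h
    tauto
  have hσ : Set.InjOn σ {t | t ∈ M} := by
    intro s hs t ht hst
    have h1 := hM' s hs
    have h2 := hM' t ht
    simp only [σ, Prod.mk.injEq] at hst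
    ext <;> omega
  let S := M.toFinset.image σ
  have hSv : ∀ t ∈ S, t.1 ≤ 2 * k ∧ t.2.1 ≤ 2 * k ∧ t.2.2 ≤ 2 * k ∧ t.1 ≠ t.2.1 := by
    intro t ht
    obtain ⟨s, hs, rfl⟩ := Finset.mem_image.1 ht
    have h1 := hM' s (Multiset.mem_toFinset.1 hs)
    simp only [σ]
    omega
  let F : ℕ × ℕ × ℕ → ↥(W k) ⊗[ℂ] ↥(V k 2) := fun t => cosz k t.1 t.2.1 t.2.2
  have hspan : Submodule.span ℂ (F '' ↑S) = LinearMap.ker (f1 k) := by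
    apply le_antisymm
    · rw [Submodule.span_le]
      rintro _ ⟨t, ht, rfl⟩
      obtain ⟨h1, h2, h3, -⟩ := hSv t ht
      exact f1_cosz k _ _ _ h1 h2 h3
    · intro z hz
      by_contra hcon
      obtain ⟨φ, hφ, hφ0⟩ := Submodule.exists_le_ker_of_notMem
        (K := ℂ) (V := ↥(W k) ⊗[ℂ] ↥(V k 2)) hcon
      obtain ⟨ψ, rfl⟩ := exists_factor k {t | t ∈ M}
        (fun t ht => ⟨(hM t ht).1, (hM t ht).2.1, (hM t ht).2.2.1⟩) hrig φ (fun t ht =>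
          LinearMap.mem_ker.1 (hφ0 (Submodule.subset_span ⟨σ t, by
            simp only [S, Finset.coe_image]
            exact ⟨t, by simpa using ht, rfl⟩, rfl⟩)))
      apply hφ
      rw [LinearMap.comp_apply, LinearMap.mem_ker.1 hz, map_zero]
  have hker := finrank_ker_f1 k hk
  have hMc : M.card = 12 * k ^ 2 - 4 * k := by
    have : 4 * k ≤ 12 * k ^ 2 := by nlinarith
    zify [this]
    exact hcard
  have hScard : S.card = M.toFinset.card := Finset.card_image_of_injOn (by
    intro s hs t ht
    exact hσ (by simpa using hs) (by simpa using ht))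
  have hrange : Set.range (fun t : S => F t.1) = F '' ↑S := by
    ext z
    simp
  have hle : Module.finrank ℂ (LinearMap.ker (f1 k)) ≤ S.card := by
    rw [← hspan, ← hrange]
    have := finrank_range_le_card (R := ℂ) (fun t : S => F t.1)
    simpa [Set.finrank] using this
  have hle2 := Multiset.toFinset_card_le M
  have hnd : M.Nodup := Multiset.toFinset_card_eq_card_iff_nodup.1 (by omega)
  refine ⟨S, hSv, ⟨?_, hspan⟩, ?_⟩
  · change LinearIndependent ℂ (fun t : S => F t.1)
    rw [linearIndependent_iff_card_eq_finrank_span, Set.finrank, hrange, hspan]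
    simp only [Fintype.card_coe]
    omega
  · rw [Finset.sum_image (by
      intro s hs t ht
      exact hσ (by simpa using hs) (by simpa using ht))]
    rw [Finset.sum, Multiset.toFinset_val, hnd.dedup]
    exact hw

lemma Rigid.reflect {k d : ℤ} {S : Set (ℤ × ℤ × ℤ)}
    (h : Rigid k (-d) ((fun t => (-t.1, -t.2.1, -t.2.2)) ⁻¹' S)) : Rigid k d S := by
  intro p q hpq
  obtain ⟨P, Q, hPQ⟩ := h (fun i => p (-i)) (fun i => q (-i)) (by
    intro a b c hm hd
    have := hpq (-a) (-b) (-c) hm (by omega)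
    simpa [label] using this)
  refine ⟨P, Q, fun a b c ha hb hc hd => ?_⟩
  have := hPQ (-a) (-b) (-c) (by simpa) (by simpa) (by simpa) (by omega)
  simpa [label] using this

lemma affine_eq {p q P Q s t : ℝ} (h1 : p + q * s = P + Q * s) (h2 : p + q * t = P + Q * t)
    (hne : s ≠ t) : p = P ∧ q = Q := by
  have h : (q - Q) * (s - t) = 0 := by linear_combination h1 - h2
  have hq : q = Q := by
    rcases mul_eq_zero.1 h with h | h
    · linarith
    · exact absurd (by linarith) hne
  subst hq
  exact ⟨by linarith, rfl⟩

/-- The edges used when the weight at the central and extreme indices is non-negative. -/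
structure CentralEdges (k : ℤ) (S : Set (ℤ × ℤ × ℤ)) : Prop where
  zero : ∀ b e, |b| < k → b ≠ 0 → |e| < k → (b, 0, e) ∈ S
  top : ∀ b i, |b| < k → -k < i → i ≤ k → (b, k, i) ∈ S
  bot : ∀ b i, |b| < k → -k ≤ i → i < k → (b, -k, i) ∈ S
  top_bot : ∀ b, 0 < b → b < k → (b, k, -k) ∈ S
  bot_top : ∀ b, b < 0 → -k < b → (b, -k, k) ∈ S
  ends_neg : ∀ i, -k ≤ i → i < 0 → (k, -k, i) ∈ S
  ends_pos : ∀ i, 0 < i → i ≤ k → (-k, k, i) ∈ S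
  end_top : (k, 0, -k) ∈ S
  end_bot : (-k, 0, k) ∈ S
  cross : ∀ i, |i| < k → i ≠ 0 → (i, -i, i) ∈ S

lemma CentralEdges.reflect {k : ℤ} {S : Set (ℤ × ℤ × ℤ)} (h : CentralEdges k S) :
    CentralEdges k ((fun t => (-t.1, -t.2.1, -t.2.2)) ⁻¹' S) where
  zero b e hb h0 he := by simpa using h.zero (-b) (-e) (by simpa) (by simpa) (by simpa)
  top b i hb h1 h2 := by simpa using h.bot (-b) (-i) (by simpa) (by omega) (by omega)
  bot b i hb h1 h2 := by simpa using h.top (-b) (-i) (by simpa) (by omega) (by omega)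
  top_bot b h1 h2 := by simpa using h.bot_top (-b) (by omega) (by omega)
  bot_top b h1 h2 := by simpa using h.top_bot (-b) (by omega) (by omega)
  ends_neg i h1 h2 := by simpa using h.ends_pos (-i) (by omega) (by omega)
  ends_pos i h1 h2 := by simpa using h.ends_neg (-i) (by omega) (by omega)
  end_top := by simpa using h.end_bot
  end_bot := by simpa using h.end_top
  cross i h1 h2 := by simpa using h.cross (-i) (by simpa) (by simpa)

lemma CentralEdges.rigid_of_nonneg {k d : ℤ} (hk : 2 ≤ k) (hd : 0 ≤ d) {S : Set (ℤ × ℤ × ℤ)}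
    (h : CentralEdges k S) : Rigid k d S := by
  intro p q hpq
  have hE : ∀ a b c s : ℤ, (a, b, c) ∈ S → a + b + c = d → label a b c = s →
      p a + q a * s = p b + q b * s := by
    rintro a b c s hm hd rfl
    exact hpq a b c hm hd
  simp only [label, abs_eq_max_neg] at hE ⊢
  have hcast : ∀ s t : ℤ, s ≠ t → (s : ℝ) ≠ t := fun s t h => by exact_mod_cast h
  have hzero : ∀ b e, -k < b → b < k → b ≠ 0 → -k < e → e < k → (b, 0, e) ∈ S :=
    fun b e h1 h2 h3 h4 h5 => h.zero b e (abs_lt.2 ⟨h1, h2⟩) h3 (abs_lt.2 ⟨h4, h5⟩)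
  have htop : ∀ b i, -k < b → b < k → -k < i → i ≤ k → (b, k, i) ∈ S :=
    fun b i h1 h2 h3 h4 => h.top b i (abs_lt.2 ⟨h1, h2⟩) h3 h4
  have hbot : ∀ b i, -k < b → b < k → -k ≤ i → i < k → (b, -k, i) ∈ S :=
    fun b i h1 h2 h3 h4 => h.bot b i (abs_lt.2 ⟨h1, h2⟩) h3 h4
  rcases le_or_gt k d with hkd | hkd
  · refine ⟨p k, q k, fun a b c ha hb hc habc => ?_⟩
    rcases eq_or_ne a k with rfl | hak
    · rfl
    rcases eq_or_ne a (-k) with rfl | hak'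
    · obtain rfl : b = k := by omega
      obtain rfl : c = b := by omega
      exact hE _ _ _ _ (h.ends_pos c (by omega) (by omega)) habc rfl
    rcases le_or_gt a (d - k) with hl | hl
    · exact hE a k (d - a - k) _ (htop _ _ (by omega) (by omega) (by omega) (by omega))
        (by omega) (by omega)
    · have h1 := hE a k (d - a - k) (2 * k + 2 * a - d)
        (htop _ _ (by omega) (by omega) (by omega) (by omega)) (by omega) (by omega)
      have h0 := hE 0 k (d - k) d
        (htop _ _ (by omega) (by omega) (by omega) (by omega)) (by omega) (by omega)
      have h2 : p a + q a * d = p k + q k * d := by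
        rcases eq_or_ne a 0 with rfl | ha0
        · exact h0
        · rw [← h0]
          exact hE a 0 (d - a) d (hzero _ _ (by omega) (by omega) ha0 (by omega) (by omega))
            (by omega) (by omega)
      obtain ⟨e1, e2⟩ := affine_eq h1 h2 (hcast _ _ (by omega))
      rw [e1, e2]
  rcases eq_or_lt_of_le hd with rfl | hd0
  · refine ⟨p 0, q 0, fun a b c ha hb hc habc => ?_⟩
    have hm := hE (-k) 0 k (2 * k) h.end_bot (by omega) (by omega)
    have hp := hE k 0 (-k) (2 * k) h.end_top (by omega) (by omega)
    rcases eq_or_ne a k with rfl | hak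
    · rw [← hE a 0 (-a) _ h.end_top (by omega) (by omega)]
    rcases eq_or_ne a (-k) with rfl | hak'
    · rw [← hE (-k) 0 k _ h.end_bot (by omega) (by omega)]
    rcases lt_trichotomy a 0 with ha0 | rfl | ha0
    · have h1 := hE a 0 (-a) (-2 * a)
        (hzero _ _ (by omega) (by omega) (by omega) (by omega) (by omega)) (by omega) (by omega)
      have h2 := hE a k (-k - a) (2 * k)
        (htop _ _ (by omega) (by omega) (by omega) (by omega)) (by omega) (by omega)
      obtain ⟨e1, e2⟩ := affine_eq h1 (h2.trans hp) (hcast _ _ (by omega))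
      rw [e1, e2]
    · rfl
    · have h1 := hE a 0 (-a) (2 * a)
        (hzero _ _ (by omega) (by omega) (by omega) (by omega) (by omega)) (by omega) (by omega)
      have h2 := hE a (-k) (k - a) (2 * k)
        (hbot _ _ (by omega) (by omega) (by omega) (by omega)) (by omega) (by omega)
      obtain ⟨e1, e2⟩ := affine_eq h1 (h2.trans hm) (hcast _ _ (by omega))
      rw [e1, e2]
  have hk1 := hE 0 k (d - k) (2 * k - d)
    (htop _ _ (by omega) (by omega) (by omega) (by omega)) (by omega) (by omega)
  have hd1 := hE d 0 0 d
    (hzero _ _ (by omega) (by omega) (by omega) (by omega) (by omega)) (by omega) (by omega)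
  have hd2 := hE d k (-k) (2 * k + d) (h.top_bot _ (by omega) (by omega)) (by omega) (by omega)
  have hX := hE d (-d) d (3 * d) (h.cross _ (abs_lt.2 (by omega)) (by omega))
    (by omega) (by omega)
  have hdR : (0 : ℝ) < d := by exact_mod_cast hd0
  have hkR : (d : ℝ) < k := by exact_mod_cast hkd
  have hdz : p d = p 0 ∧ q d = q 0 := by
    rcases lt_or_ge (2 * d) k with h2 | h2
    · have h3 := hE (-d) 0 (2 * d) (3 * d)
        (hzero _ _ (by omega) (by omega) (by omega) (by omega) (by omega)) (by omega) (by omega)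
      exact affine_eq (hX.trans h3) hd1 (hcast _ _ (by omega))
    · have h3 := hE (-d) k (2 * d - k) (3 * d)
        (htop _ _ (by omega) (by omega) (by omega) (by omega)) (by omega) (by omega)
      have h4 := hX.trans h3
      push_cast at hk1 hd2 h4
      have e1 : k * (q d - q 0) = d * (q k - q 0) := by
        linear_combination (hd2 - hd1 - hk1) / 2
      have e2 : d * (q d - q 0) = (2 * d - k) * (q k - q 0) := by
        linear_combination (h4 - hd1 - hk1) / 2
      have hu : (q d - q 0) * (k - d : ℝ) ^ 2 = 0 := by
        linear_combination d * e2 - (2 * d - k) * e1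
      have hq : q d = q 0 := by
        rcases mul_eq_zero.1 hu with h | h
        · linarith
        · exact absurd (pow_eq_zero_iff two_ne_zero |>.1 h) (by linarith)
      rw [hq] at hd1
      exact ⟨by linarith, hq⟩
  have hkz : p k = p 0 ∧ q k = q 0 := by
    rw [hdz.1, hdz.2] at hd2
    exact affine_eq hd2.symm hk1.symm (hcast _ _ (by omega))
  have hmz : p (-k) + q (-k) * (2 * k + d : ℤ) = p 0 + q 0 * (2 * k + d : ℤ) := by
    rw [← hkz.1, ← hkz.2]
    exact hE (-k) k d _ (h.ends_pos _ (by omega) (by omega)) (by omega) (by omega)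
  refine ⟨p 0, q 0, fun a b c ha hb hc habc => ?_⟩
  have hdone : p a = p 0 ∧ q a = q 0 → p a + q a * ((max a (-a) + max b (-b) + max c (-c) : ℤ) : ℝ)
      = p 0 + q 0 * ((max a (-a) + max b (-b) + max c (-c) : ℤ) : ℝ) := fun h => by rw [h.1, h.2]
  rcases eq_or_ne a k with rfl | hak
  · exact hdone hkz
  rcases eq_or_ne a (-k) with rfl | hak'
  · convert hmz using 4 <;> omega
  rcases eq_or_ne a d with rfl | had
  · exact hdone hdz
  rcases eq_or_ne a 0 with rfl | ha0
  · rfl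
  rcases le_or_gt a (d - k) with hl | hl
  · rw [← hkz.1, ← hkz.2]
    exact hE a k (d - a - k) _ (htop _ _ (by omega) (by omega) (by omega) (by omega))
      (by omega) (by omega)
  apply hdone
  rcases lt_or_gt_of_ne had with had | had
  · have h1 := hE a 0 (d - a) (max a (-a) + d - a)
      (hzero _ _ (by omega) (by omega) ha0 (by omega) (by omega)) (by omega) (by omega)
    have h2 := hE a k (d - a - k) (max a (-a) + 2 * k - d + a)
      (htop _ _ (by omega) (by omega) (by omega) (by omega)) (by omega) (by omega)
    rw [hkz.1, hkz.2] at h2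
    exact affine_eq h1 h2 (hcast _ _ (by omega))
  · have h1 := hE a 0 (d - a) (2 * a - d)
      (hzero _ _ (by omega) (by omega) ha0 (by omega) (by omega)) (by omega) (by omega)
    have h2 := hE a (-k) (d - a + k) (2 * k + d)
      (hbot _ _ (by omega) (by omega) (by omega) (by omega)) (by omega) (by omega)
    exact affine_eq h1 (h2.trans hmz) (hcast _ _ (by omega))

lemma CentralEdges.rigid {k : ℤ} (hk : 2 ≤ k) {S : Set (ℤ × ℤ × ℤ)}
    (h : CentralEdges k S) (d : ℤ) : Rigid k d S := by
  rcases le_total 0 d with hd | hd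
  · exact h.rigid_of_nonneg hk hd
  · exact (h.reflect.rigid_of_nonneg hk (by omega)).reflect

lemma sum_Ioc_of_lt {a b : ℤ} (hab : a < b) (g : ℤ → ℚ) :
    ∑ i ∈ Finset.Ioc a b, g i = ∑ i ∈ Finset.Ioo a b, g i + g b := by
  rw [← Finset.Ioo_insert_right hab, Finset.sum_insert (by simp), add_comm]

lemma sum_Ico_of_lt {a b : ℤ} (hab : a < b) (g : ℤ → ℚ) :
    ∑ i ∈ Finset.Ico a b, g i = ∑ i ∈ Finset.Ioo a b, g i + g a := by
  rw [← Finset.Ioo_insert_left hab, Finset.sum_insert (by simp), add_comm]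

lemma sum_Icc_of_lt {a b : ℤ} (hab : a < b) (g : ℤ → ℚ) :
    ∑ i ∈ Finset.Icc a b, g i = ∑ i ∈ Finset.Ioo a b, g i + g b + g a := by
  rw [← Finset.Ioc_insert_left hab.le, Finset.sum_insert (by simp), add_comm, sum_Ioc_of_lt hab]

lemma sum_Ioo_erase {k : ℤ} (hk : 0 < k) (g : ℤ → ℚ) :
    ∑ i ∈ (Finset.Ioo (-k) k).erase 0, g i = ∑ i ∈ Finset.Ioo (-k) k, g i - g 0 := by
  rw [eq_sub_iff_add_eq, Finset.sum_erase_add]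
  simp only [Finset.mem_Ioo]
  omega

lemma sum_Ioo_split {k : ℤ} (hk : 0 < k) (g : ℤ → ℚ) : ∑ i ∈ Finset.Ioo (-k) k, g i =
    ∑ i ∈ Finset.Ioo (-k) 0, g i + ∑ i ∈ Finset.Ioo 0 k, g i + g 0 := by
  rw [← sub_eq_iff_eq_add, ← sum_Ioo_erase hk, ← Finset.sum_union]
  · congr 1
    ext i
    simp only [Finset.mem_erase, Finset.mem_union, Finset.mem_Ioo]
    omega
  · rw [Finset.disjoint_left]
    intro i
    simp only [Finset.mem_Ioo]
    omega

lemma sum_Ioo_neg (k : ℤ) (g : ℤ → ℚ) :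
    ∑ i ∈ Finset.Ioo (-k) k, g (-i) = ∑ i ∈ Finset.Ioo (-k) k, g i := by
  apply Finset.sum_nbij' (fun i => -i) (fun i => -i) <;> simp only [Finset.mem_Ioo] <;> intros <;>
    first | omega | simp

/-- The family of cosyzygies whose edges join an index to `0` or `±k` whenever possible. -/
noncomputable def plusFamily (k : ℤ) : Multiset (ℤ × ℤ × ℤ) :=
  (((Finset.Ioo (-k) k).erase 0 ×ˢ Finset.Ioo (-k) k).val.map fun x => (x.1, 0, x.2)) +
  ((Finset.Ioo (-k) k ×ˢ Finset.Ioc (-k) k).val.map fun x => (x.1, k, x.2)) +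
  ((Finset.Ioo (-k) k ×ˢ Finset.Ico (-k) k).val.map fun x => (x.1, -k, x.2)) +
  ((Finset.Ioo 0 k).val.map fun b => (b, k, -k)) +
  ((Finset.Ioo (-k) 0).val.map fun b => (b, -k, k)) +
  ((Finset.Ico (-k) 0).val.map fun i => (k, -k, i)) +
  ((Finset.Ioc 0 k).val.map fun i => (-k, k, i)) +
  {(k, 0, -k), (-k, 0, k)} +
  (((Finset.Ioo (-k) k).erase 0).val.map fun i => (i, -i, i))

lemma plusFamily_card {k : ℤ} (hk : 2 ≤ k) :
    ((plusFamily k).card : ℤ) = 12 * k ^ 2 - 4 * k := by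
  have h0 : (0 : ℤ) ∈ Finset.Ioo (-k) k := by simp; omega
  simp only [plusFamily, Multiset.card_add, Multiset.card_map, Finset.card_val,
    Finset.card_product, Finset.card_erase_of_mem h0, Int.card_Ioo, Int.card_Ioc, Int.card_Ico,
    Multiset.insert_eq_cons, Multiset.card_cons, Multiset.card_singleton]
  push_cast
  have e1 : (((k - -k - 1).toNat - 1 : ℕ) : ℤ) = 2 * k - 2 := by omega
  have e2 : (((k - -k - 1).toNat : ℕ) : ℤ) = 2 * k - 1 := by omega
  have e3 : (((k - -k).toNat : ℕ) : ℤ) = 2 * k := by omega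
  have e4 : (((k - 0 - 1).toNat : ℕ) : ℤ) = k - 1 := by omega
  have e5 : (((0 - -k - 1).toNat : ℕ) : ℤ) = k - 1 := by omega
  have e6 : (((0 - -k).toNat : ℕ) : ℤ) = k := by omega
  have e7 : (((k - 0).toNat : ℕ) : ℤ) = k := by omega
  rw [e1, e2, e3, e4, e5, e6, e7]
  ring

lemma plusFamily_valid {k : ℤ} (hk : 2 ≤ k) : ∀ t ∈ plusFamily k,
    |t.1| ≤ k ∧ |t.2.1| ≤ k ∧ |t.2.2| ≤ k ∧ t.1 ≠ t.2.1 := by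
  rintro ⟨a, b, c⟩ ht
  simp only [plusFamily, Multiset.mem_add, Multiset.mem_map, Finset.mem_val, Finset.mem_product,
    Finset.mem_erase, Finset.mem_Ioo, Finset.mem_Ioc, Finset.mem_Ico, Prod.mk.injEq,
    Multiset.insert_eq_cons, Multiset.mem_cons, Multiset.mem_singleton] at ht
  simp only [abs_le]
  rcases ht with (((((((⟨y, h, rfl, rfl, rfl⟩ | ⟨y, h, rfl, rfl, rfl⟩) | ⟨y, h, rfl, rfl, rfl⟩) |
    ⟨y, h, rfl, rfl, rfl⟩) | ⟨y, h, rfl, rfl, rfl⟩) | ⟨y, h, rfl, rfl, rfl⟩) |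
    ⟨y, h, rfl, rfl, rfl⟩) | ⟨rfl, rfl, rfl⟩ | ⟨rfl, rfl, rfl⟩) | ⟨y, h, rfl, rfl, rfl⟩
  all_goals omega

lemma plusFamily_central {k : ℤ} : CentralEdges k {t | t ∈ plusFamily k} := by
  constructor
  all_goals
    simp only [plusFamily, Set.mem_ofPred_eq, Multiset.mem_add, Multiset.mem_map, Finset.mem_val,
      Finset.mem_product, Finset.mem_erase, Finset.mem_Ioo, Finset.mem_Ioc, Finset.mem_Ico,
      Multiset.insert_eq_cons, Multiset.mem_cons, Multiset.mem_singleton, Prod.exists, abs_lt]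
  · intro b e hb h0 he
    iterate 8 left
    exact ⟨b, e, by omega, rfl⟩
  · intro b i hb h1 h2
    iterate 7 left
    exact Or.inr ⟨b, i, by omega, rfl⟩
  · intro b i hb h1 h2
    iterate 6 left
    exact Or.inr ⟨b, i, by omega, rfl⟩
  · intro b h1 h2
    iterate 5 left
    exact Or.inr ⟨b, by omega, rfl⟩
  · intro b h1 h2
    iterate 4 left
    exact Or.inr ⟨b, by omega, rfl⟩
  · intro b h1 h2
    iterate 3 left
    exact Or.inr ⟨b, by omega, rfl⟩
  · intro b h1 h2
    iterate 2 left
    exact Or.inr ⟨b, by omega, rfl⟩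
  · exact Or.inl (Or.inr (Or.inl trivial))
  · exact Or.inl (Or.inr (Or.inr trivial))
  · intro i h1 h2
    exact Or.inr ⟨i, by omega, rfl⟩


lemma plusFamily_weight {k : ℤ} (hk : 2 ≤ k) (R : ℤ → ℚ)
    (hR : ∑ i ∈ Finset.Icc (-k) k, R i = 0) :
    ((plusFamily k).map (wt R)).sum = (4 * k ^ 2 - 8 * k) * (R 0 + R k + R (-k)) := by
  have hk0 : (0 : ℤ) < k := by omega
  have hneg : -k < 0 := by omega
  rw [sum_Icc_of_lt (by omega)] at hR
  have hs := sum_Ioo_split hk0 R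
  have hm := sum_Ioo_neg k R
  have e1 : (((Finset.Ioo (-k) k).card : ℤ) : ℚ) = 2 * k - 1 := by
    rw [Int.card_Ioo, Int.toNat_of_nonneg (by omega)]
    push_cast
    ring
  have e2 : (((Finset.Ioo (-k) 0).card : ℤ) : ℚ) = k - 1 := by
    rw [Int.card_Ioo, Int.toNat_of_nonneg (by omega)]
    push_cast
    ring
  have e3 : (((Finset.Ioo 0 k).card : ℤ) : ℚ) = k - 1 := by
    rw [Int.card_Ioo, Int.toNat_of_nonneg (by omega)]
    push_cast
    ring
  push_cast at e1 e2 e3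
  simp only [plusFamily, Multiset.map_add, Multiset.map_map, Multiset.sum_add,
    Multiset.insert_eq_cons, Multiset.map_cons, Multiset.map_singleton, Multiset.sum_cons,
    Multiset.sum_singleton, Function.comp_def, wt]
  change ∑ t ∈ _, _ + ∑ t ∈ _, _ + ∑ t ∈ _, _ + ∑ t ∈ _, _ + ∑ t ∈ _, _ + ∑ t ∈ _, _ +
    ∑ t ∈ _, _ + _ + ∑ t ∈ _, _ = _
  simp only [Finset.sum_product]
  simp only [sum_Ioo_erase hk0, sum_Ioc_of_lt hk0, sum_Ico_of_lt hneg,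
    sum_Ioc_of_lt (show -k < k by omega), sum_Ico_of_lt (show -k < k by omega),
    Finset.sum_add_distrib, Finset.sum_const, nsmul_eq_mul, e1, e2, e3, hm,
    ← Finset.mul_sum, neg_zero]
  have hT : ∑ i ∈ Finset.Ioo (-k) k, R i = -(R k + R (-k)) := by linarith
  have hT' : ∑ i ∈ Finset.Ioo (-k) 0, R i = -(R k + R (-k) + R 0) - ∑ i ∈ Finset.Ioo 0 k, R i := by
    linarith
  rw [hT', hT]
  ring

/-- Two families of reals, indexed by `1 ≤ m ≤ N` and `1 ≤ y ≤ K`, with poles `X μ` and `Y ν`: each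
entry before a pole is a weighted mean, and each entry beyond a pole an extrapolation, of entries
closer to the poles. -/
structure TwoPole (N K μ ν : ℤ) (X Y : ℤ → ℝ) : Prop where
  one_le_μ : 1 ≤ μ
  one_le_ν : 1 ≤ ν
  innerY : ∀ y, 1 ≤ y → y < ν → ∃ z m, ∃ t : ℝ, y < z ∧ z ≤ ν ∧ 1 ≤ m ∧ m ≤ μ ∧ 0 ≤ t ∧ t < 1 ∧
    Y y = (1 - t) * Y z + t * X m
  innerX : ∀ m, 1 ≤ m → m < μ → ∃ z y, ∃ t : ℝ, m < z ∧ z ≤ μ ∧ 1 ≤ y ∧ y ≤ ν ∧ 0 < t ∧ t ≤ 1 ∧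
    X m = (1 - t) * X z + t * Y y
  outerY : ∀ y, ν < y → y ≤ K → ∃ z m, ∃ t : ℝ, ν ≤ z ∧ z < y ∧ 1 ≤ m ∧ m ≤ μ ∧ 0 ≤ t ∧
    Y y = (1 + t) * Y z - t * X m
  outerX : ∀ m, μ < m → m ≤ N → ∃ z y, ∃ t : ℝ, μ ≤ z ∧ z < m ∧ 1 ≤ y ∧ y ≤ ν ∧ 0 ≤ t ∧
    X m = (1 + t) * X z - t * Y y

namespace TwoPole

variable {N K μ ν : ℤ} {X Y : ℤ → ℝ}

lemma neg (h : TwoPole N K μ ν X Y) : TwoPole N K μ ν (fun m => -X m) (fun y => -Y y) where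
  one_le_μ := h.one_le_μ
  one_le_ν := h.one_le_ν
  innerY y h1 h2 := by
    obtain ⟨z, m, t, a1, a2, a3, a4, a5, a6, e⟩ := h.innerY y h1 h2
    exact ⟨z, m, t, a1, a2, a3, a4, a5, a6, by linear_combination -e⟩
  innerX y h1 h2 := by
    obtain ⟨z, m, t, a1, a2, a3, a4, a5, a6, e⟩ := h.innerX y h1 h2
    exact ⟨z, m, t, a1, a2, a3, a4, a5, a6, by linear_combination -e⟩
  outerY y h1 h2 := by
    obtain ⟨z, m, t, a1, a2, a3, a4, a5, e⟩ := h.outerY y h1 h2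
    exact ⟨z, m, t, a1, a2, a3, a4, a5, by linear_combination -e⟩
  outerX y h1 h2 := by
    obtain ⟨z, m, t, a1, a2, a3, a4, a5, e⟩ := h.outerX y h1 h2
    exact ⟨z, m, t, a1, a2, a3, a4, a5, by linear_combination -e⟩

/-- The maximum principle: entries before the poles are bounded by the values at the poles. -/
lemma le_of_poles (h : TwoPole N K μ ν X Y) {U : ℝ} (hX : X μ ≤ U) (hY : Y ν ≤ U) :
    (∀ m, 1 ≤ m → m ≤ μ → X m ≤ U) ∧ (∀ y, 1 ≤ y → y ≤ ν → Y y ≤ U) := by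
  have h1 := h.one_le_μ
  have h2 := h.one_le_ν
  obtain ⟨m₀, hm₀, hmax⟩ := Finset.exists_max_image (Finset.Icc 1 μ) X ⟨μ, by simp [h1]⟩
  obtain ⟨y₀, hy₀, hmay⟩ := Finset.exists_max_image (Finset.Icc 1 ν) Y ⟨ν, by simp [h2]⟩
  rw [Finset.mem_Icc] at hm₀ hy₀
  have hmX : ∀ m, 1 ≤ m → m ≤ μ → X m ≤ max (X m₀) (Y y₀) := fun m a b =>
    (hmax m (Finset.mem_Icc.2 ⟨a, b⟩)).trans (le_max_left _ _)
  have hmY : ∀ y, 1 ≤ y → y ≤ ν → Y y ≤ max (X m₀) (Y y₀) := fun m a b =>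
    (hmay m (Finset.mem_Icc.2 ⟨a, b⟩)).trans (le_max_right _ _)
  generalize hT : max (X m₀) (Y y₀) = T at hmX hmY
  have chainY : ∀ n : ℕ, ∀ y, 1 ≤ y → y ≤ ν → (ν - y).toNat ≤ n → Y y = T → T ≤ U := by
    intro n
    induction n with
    | zero =>
      intro y hy1 hy2 hn hyT
      obtain rfl : y = ν := by omega
      linarith
    | succ n ih =>
      intro y hy1 hy2 hn hyT
      rcases eq_or_lt_of_le hy2 with rfl | hlt
      · linarith
      obtain ⟨z, m, t, a1, a2, a3, a4, a5, a6, e⟩ := h.innerY y hy1 hlt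
      refine ih z (by omega) a2 (by omega) (le_antisymm (hmY z (by omega) a2) ?_)
      have := hmX m a3 a4
      nlinarith
  have chainX : ∀ n : ℕ, ∀ m, 1 ≤ m → m ≤ μ → (μ - m).toNat ≤ n → X m = T → T ≤ U := by
    intro n
    induction n with
    | zero =>
      intro y hy1 hy2 hn hyT
      obtain rfl : y = μ := by omega
      linarith
    | succ n ih =>
      intro m hm1 hm2 hn hmT
      rcases eq_or_lt_of_le hm2 with rfl | hlt
      · linarith
      obtain ⟨z, y, t, a1, a2, a3, a4, a5, a6, e⟩ := h.innerX m hm1 hlt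
      refine chainY _ y a3 a4 le_rfl (le_antisymm (hmY y a3 a4) ?_)
      have := hmX z (by omega) a2
      nlinarith
  have hTU : T ≤ U := by
    rcases max_choice (X m₀) (Y y₀) with e | e
    · exact chainX _ m₀ hm₀.1 hm₀.2 le_rfl (by rw [← hT, e])
    · exact chainY _ y₀ hy₀.1 hy₀.2 le_rfl (by rw [← hT, e])
  exact ⟨fun m a b => (hmX m a b).trans hTU, fun y a b => (hmY y a b).trans hTU⟩

lemma le_inner (h : TwoPole N K μ ν X Y) (hXY : X μ ≤ Y ν) :
    (∀ m, 1 ≤ m → m ≤ μ → X μ ≤ X m) ∧ (∀ y, 1 ≤ y → y ≤ ν → X μ ≤ Y y) := by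
  have := h.neg.le_of_poles (U := -X μ) le_rfl (by linarith)
  simpa using this

lemma outer (h : TwoPole N K μ ν X Y) (hXY : X μ ≤ Y ν) :
    (∀ m, μ ≤ m → m ≤ N → X m ≤ X μ) ∧ (∀ y, ν ≤ y → y ≤ K → Y ν ≤ Y y) := by
  have hi := h.le_inner hXY
  have hu := h.le_of_poles hXY le_rfl
  constructor
  · suffices ∀ n : ℕ, ∀ m, μ ≤ m → m ≤ N → (m - μ).toNat ≤ n → X m ≤ X μ from
      fun m a b => this _ m a b le_rfl
    intro n
    induction n with
    | zero =>
      intro m a b c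
      obtain rfl : m = μ := by omega
      exact le_rfl
    | succ n ih =>
      intro m a b c
      rcases eq_or_lt_of_le a with rfl | hlt
      · exact le_rfl
      obtain ⟨z, y, t, a1, a2, a3, a4, a5, e⟩ := h.outerX m hlt b
      have h1 := ih z a1 (by omega) (by omega)
      have h2 := hi.2 y a3 a4
      nlinarith
  · suffices ∀ n : ℕ, ∀ y, ν ≤ y → y ≤ K → (y - ν).toNat ≤ n → Y ν ≤ Y y from
      fun m a b => this _ m a b le_rfl
    intro n
    induction n with
    | zero =>
      intro m a b c
      obtain rfl : m = ν := by omega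
      exact le_rfl
    | succ n ih =>
      intro y a b c
      rcases eq_or_lt_of_le a with rfl | hlt
      · exact le_rfl
      obtain ⟨z, m, t, a1, a2, a3, a4, a5, e⟩ := h.outerY y hlt b
      have h1 := ih z a1 (by omega) (by omega)
      have h2 := hu.1 m a3 a4
      nlinarith

lemma lt_inner (h : TwoPole N K μ ν X Y) (hXY : X μ < Y ν) :
    ∀ y, 1 ≤ y → y ≤ ν → X μ < Y y := by
  have hi := h.le_inner hXY.le
  suffices ∀ n : ℕ, ∀ y, 1 ≤ y → y ≤ ν → (ν - y).toNat ≤ n → X μ < Y y from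
    fun m a b => this _ m a b le_rfl
  intro n
  induction n with
  | zero =>
    intro y a b c
    obtain rfl : y = ν := by omega
    exact hXY
  | succ n ih =>
    intro y a b c
    rcases eq_or_lt_of_le b with rfl | hlt
    · exact hXY
    obtain ⟨z, m, t, a1, a2, a3, a4, a5, a6, e⟩ := h.innerY y a hlt
    have h1 := ih z (by omega) a2 (by omega)
    have h2 := hi.1 m a3 a4
    nlinarith

/-- If the poles agree, all entries do. -/
lemma eq_of_poles (h : TwoPole N K μ ν X Y) (hXY : X μ = Y ν) :
    (∀ m, 1 ≤ m → m ≤ N → X m = Y ν) ∧ (∀ y, 1 ≤ y → y ≤ K → Y y = Y ν) := by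
  have h1 := h.le_of_poles (U := Y ν) hXY.le le_rfl
  have h2 := h.le_inner hXY.le
  have h3 := h.outer hXY.le
  have h4 := h.neg.outer (by simp [hXY])
  simp only [neg_le_neg_iff] at h4
  constructor
  · intro m a b
    rcases le_total m μ with hm | hm
    · exact le_antisymm (h1.1 m a hm) (hXY ▸ h2.1 m a hm)
    · exact hXY ▸ le_antisymm (h3.1 m hm b) (h4.1 m hm b)
  · intro y a b
    rcases le_total y ν with hm | hm
    · exact le_antisymm (h1.2 y a hm) (hXY ▸ h2.2 y a hm)
    · exact le_antisymm (h4.2 y hm b) (h3.2 y hm b)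

/-- The poles agree if two entries with the same index beyond the first pole do. -/
lemma poles_eq_of_eq (h : TwoPole N K μ ν X Y) {n : ℤ} (h1 : μ ≤ n) (h2 : n ≤ N) (h3 : n ≤ K)
    (hn : X n = Y n) : X μ = Y ν := by
  have hμ := h.one_le_μ
  have key : ∀ X Y : ℤ → ℝ, TwoPole N K μ ν X Y → X n = Y n → ¬ X μ < Y ν := by
    intro X Y h hn hlt
    have e1 := (h.outer hlt.le).1 n h1 h2
    rcases le_total n ν with hm | hm
    · have := h.lt_inner hlt n (by omega) hm
      linarith
    · have := (h.outer hlt.le).2 n hm h3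
      linarith
  refine le_antisymm (not_lt.1 fun hlt => ?_) (not_lt.1 (key X Y h hn))
  exact key _ _ h.neg (by simp [hn]) (by simpa)

/-- The poles agree if an entry near the second pole is a proper extrapolation of entries beyond the
poles. -/
lemma poles_eq_of_extrapolation (h : TwoPole N K μ ν X Y) {n w z : ℤ} {t : ℝ} (h1 : μ ≤ n)
    (h2 : n ≤ N) (h3 : ν ≤ w) (h4 : w ≤ K) (hz : 1 ≤ z) (hzν : z ≤ ν ∨ Y z = Y ν) (ht : 0 < t)
    (he : Y z = (1 + t) * Y w - t * X n) : X μ = Y ν := by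
  have key : ∀ X Y : ℤ → ℝ, TwoPole N K μ ν X Y → (z ≤ ν ∨ Y z = Y ν) →
      Y z = (1 + t) * Y w - t * X n → ¬ X μ < Y ν := by
    intro X Y h hzν he hlt
    have e1 := (h.outer hlt.le).1 n h1 h2
    have e2 := (h.outer hlt.le).2 w h3 h4
    have e3 : Y z ≤ Y ν := by
      rcases hzν with hz' | hz'
      · exact (h.le_of_poles hlt.le le_rfl).2 z hz hz'
      · exact hz'.le
    nlinarith
  refine le_antisymm (not_lt.1 fun hlt => ?_) (not_lt.1 (key X Y h hzν he))
  exact key _ _ h.neg (by simpa using hzν) (by linear_combination -he) (by simpa)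

end TwoPole

/-- A function that repeats its values towards `ν` is constant. -/
lemma eq_of_chain {K ν : ℤ} {Y : ℤ → ℝ}
    (h : ∀ y, ν < y → y ≤ K → ∃ z, ν ≤ z ∧ z < y ∧ Y y = Y z) :
    ∀ y, ν ≤ y → y ≤ K → Y y = Y ν := by
  suffices ∀ n : ℕ, ∀ y, ν ≤ y → y ≤ K → (y - ν).toNat ≤ n → Y y = Y ν from
    fun m a b => this _ m a b le_rfl
  intro n
  induction n with
  | zero =>
    intro y a b c
    obtain rfl : y = ν := by omega
    rfl
  | succ n ih =>
    intro y a b c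
    rcases eq_or_lt_of_le a with rfl | hlt
    · rfl
    obtain ⟨z, a1, a2, e⟩ := h y hlt b
    rw [e]
    exact ih z a1 (by omega) (by omega)

/-- The edges used in degree `d` when the weight at the central and extreme indices is negative. -/
structure SpreadEdges (k d : ℤ) (S : Set (ℤ × ℤ × ℤ)) : Prop where
  base : ∀ b, 0 ≤ b → b ≤ d → b ≤ k → d - 2 * k ≤ b → b ≠ (d + 1) / 3 →
    ∃ p, 0 ≤ p ∧ p ≤ k ∧ 0 ≤ d - b - p ∧ d - b - p ≤ k ∧ |3 * p - d| < |3 * b - d| ∧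
      (b, p, d - b - p) ∈ S
  over_lo : ∀ m, 1 ≤ m → m < (2 * (k - d) + 2) / 3 → (d + m, -((m + 1) / 2), -(m / 2)) ∈ S
  over_hi : ∀ m, 1 ≤ m → (2 * (k - d) + 2) / 3 < m → d + m ≤ k →
    (d + m, -(m / 2), -((m + 1) / 2)) ∈ S
  under_lo : ∀ y, 1 ≤ y → y < (2 * k - d + 2) / 3 → y ≤ k → y ≤ 2 * k - d → d ≠ 0 ∨ y ≠ 1 →
    (-y, (d + y + 1) / 2, (d + y) / 2) ∈ S
  under_one : d = 0 → (-1, 0, 1) ∈ S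
  under_hi : ∀ y, 1 ≤ y → (2 * k - d + 2) / 3 < y → y ≤ k → y ≤ 2 * k - d →
    (-y, (d + y) / 2, (d + y + 1) / 2) ∈ S
  plane_nonneg : ∀ b, 0 ≤ b → b ≤ k → -k < d - b → d - b < k →
    (b, -((k + b - d + 1) / 2), d - b + (k + b - d + 1) / 2) ∈ S
  plane_neg : ∀ y, 1 ≤ y → y < k - d → (-y, (d + y + k + 1) / 2, d + y - (d + y + k + 1) / 2) ∈ S
  close : d < k → (k, d - k, 0) ∈ S ∨ (2 ≤ d ∧ (k, d, -k) ∈ S)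

lemma eq_mean_of_line {m z y X Y Y' : ℝ} (hy : y ≠ 0) (hzm : z - m ≠ 0)
    (h : (z - m) * (y * Y) = (z - y) * (m * X) + (y - m) * (z * Y')) :
    Y = (1 - (z - y) * m / ((z - m) * y)) * Y' + (z - y) * m / ((z - m) * y) * X := by
  field_simp
  linear_combination h

lemma eq_extrapolation_of_line {m z y X Y Y' : ℝ} (hy : y ≠ 0) (hzm : z - m ≠ 0)
    (h : (z - m) * (y * Y) = (z - y) * (m * X) + (y - m) * (z * Y')) :
    Y = (1 + (y - z) * m / ((z - m) * y)) * Y' - (y - z) * m / ((z - m) * y) * X := by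
  field_simp
  linear_combination h

/-- The consequences of `SpreadEdges` for functions constant along all edges, after normalisation:
`v` is the common value at label `d`, and `X m`, `Y y` are the slopes from there to the values at
`d + m` and `-y` with labels `d + 2 * m` and `d + 2 * y`. -/
structure SpreadValues (k d : ℤ) (p q : ℤ → ℝ) (v : ℝ) (X Y : ℤ → ℝ) : Prop where
  base : ∀ b, 0 ≤ b → b ≤ d → b ≤ k → d - 2 * k ≤ b → p b + q b * d = v
  valX : ∀ m, 1 ≤ m → p (d + m) + q (d + m) * (d + 2 * m) = v + m * X m
  valY : ∀ y, 1 ≤ y → p (-y) + q (-y) * (d + 2 * y) = v + y * Y y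
  fib_mid : ∀ b, ∀ h : ℝ, 0 ≤ b → b ≤ d → b ≤ k → d - k < b →
    p b + q b * (d + 2 * h) = v + h * Y ((k + b - d + 1) / 2)
  fib_over : ∀ m, ∀ h : ℝ, 1 ≤ m → m < k → d + m ≤ k →
    (((k + m + 1) / 2 : ℤ) - m) * (p (d + m) + q (d + m) * (d + 2 * h) - v) =
      (((k + m + 1) / 2 : ℤ) - h) * (m * X m) +
        (h - m) * (((k + m + 1) / 2 : ℤ) * Y ((k + m + 1) / 2))
  fib_under : ∀ y, ∀ h : ℝ, 1 ≤ y → y < k - d →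
    (((k - d + y + 1) / 2 : ℤ) - y) * (p (-y) + q (-y) * (d + 2 * h) - v) =
      (((k - d + y + 1) / 2 : ℤ) - h) * (y * Y y) +
        (h - y) * (((k - d + y + 1) / 2 : ℤ) * X ((k - d + y + 1) / 2))
  over_lo : ∀ m, 1 ≤ m → m < (2 * (k - d) + 2) / 3 →
    v + m * X m = p (-((m + 1) / 2)) + q (-((m + 1) / 2)) * (d + 2 * m)
  over_hi : ∀ m, 1 ≤ m → (2 * (k - d) + 2) / 3 < m → d + m ≤ k →
    v + m * X m = p (-(m / 2)) + q (-(m / 2)) * (d + 2 * m)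
  under_lo : ∀ y, 1 ≤ y → y < (2 * k - d + 2) / 3 → y ≤ k → y ≤ 2 * k - d → d ≠ 0 ∨ y ≠ 1 →
    v + y * Y y = p ((d + y + 1) / 2) + q ((d + y + 1) / 2) * (d + 2 * y)
  under_one : d = 0 → v + Y 1 = p 0 + q 0 * (d + 2 * 1)
  under_hi : ∀ y, 1 ≤ y → (2 * k - d + 2) / 3 < y → y ≤ k → y ≤ 2 * k - d →
    v + y * Y y = p ((d + y) / 2) + q ((d + y) / 2) * (d + 2 * y)
  close : d < k → X (k - d) = Y (k - d) ∨
    (2 ≤ d ∧ p k + q k * (d + 2 * k) = v + k * Y ((k + 1) / 2))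

lemma SpreadEdges.base_value {k d : ℤ} {S : Set (ℤ × ℤ × ℤ)} (h : SpreadEdges k d S)
    {p q : ℤ → ℝ} (hpq : ∀ a b c, (a, b, c) ∈ S → a + b + c = d →
      p a + q a * label a b c = p b + q b * label a b c) :
    ∀ b, 0 ≤ b → b ≤ d → b ≤ k → d - 2 * k ≤ b →
      p b + q b * d = p ((d + 1) / 3) + q ((d + 1) / 3) * d := by
  suffices ∀ n : ℕ, ∀ b, 0 ≤ b → b ≤ d → b ≤ k → d - 2 * k ≤ b → (|3 * b - d|).toNat ≤ n →
      p b + q b * d = p ((d + 1) / 3) + q ((d + 1) / 3) * d from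
    fun b h1 h2 h3 h4 => this _ b h1 h2 h3 h4 le_rfl
  intro n
  induction n with
  | zero =>
    intro b h1 h2 h3 h4 h5
    rw [abs_eq_max_neg] at h5
    obtain rfl : b = (d + 1) / 3 := by omega
    rfl
  | succ n ih =>
    intro b h1 h2 h3 h4 h5
    rcases eq_or_ne b ((d + 1) / 3) with rfl | hb
    · rfl
    obtain ⟨c, c1, c2, c3, c4, c5, hm⟩ := h.base b h1 h2 h3 h4 hb
    have hl : label b c (d - b - c) = d := by
      simp only [label, abs_eq_max_neg]
      omega
    have e := hpq _ _ _ hm (by omega)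
    rw [hl] at e
    rw [e]
    refine ih c c1 (by omega) c2 (by omega) ?_
    rw [abs_eq_max_neg, abs_eq_max_neg] at c5
    rw [abs_eq_max_neg] at h5 ⊢
    omega

lemma SpreadEdges.exists_values {k d : ℤ} {S : Set (ℤ × ℤ × ℤ)} (hk : 3 ≤ k) (hd : 0 ≤ d)
    (hd2 : d < 2 * k) (h : SpreadEdges k d S) {p q : ℤ → ℝ}
    (hpq : ∀ a b c, (a, b, c) ∈ S → a + b + c = d →
      p a + q a * label a b c = p b + q b * label a b c) :
    ∃ v X Y, SpreadValues k d p q v X Y := by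
  have hE : ∀ a b c s : ℤ, (a, b, c) ∈ S → a + b + c = d → label a b c = s →
      p a + q a * s = p b + q b * s := by
    rintro a b c s hm hd rfl
    exact hpq a b c hm hd
  simp only [label, abs_eq_max_neg] at hE
  obtain ⟨v, hv⟩ : ∃ v, v = p ((d + 1) / 3) + q ((d + 1) / 3) * d := ⟨_, rfl⟩
  obtain ⟨X, hX⟩ : ∃ X : ℤ → ℝ,
      X = fun m : ℤ => (p (d + m) + q (d + m) * (d + 2 * m) - v) / m := ⟨_, rfl⟩
  obtain ⟨Y, hY⟩ : ∃ Y : ℤ → ℝ,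
      Y = fun y : ℤ => (p (-y) + q (-y) * (d + 2 * y) - v) / y := ⟨_, rfl⟩
  have valX : ∀ m : ℤ, 1 ≤ m → p (d + m) + q (d + m) * (d + 2 * m) = v + m * X m := by
    intro m hm
    have : (m : ℝ) ≠ 0 := by exact_mod_cast (by omega : m ≠ 0)
    rw [hX]
    field_simp
    ring
  have valY : ∀ y : ℤ, 1 ≤ y → p (-y) + q (-y) * (d + 2 * y) = v + y * Y y := by
    intro m hm
    have : (m : ℝ) ≠ 0 := by exact_mod_cast (by omega : m ≠ 0)
    rw [hY]
    field_simp
    ring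
  have base : ∀ b, 0 ≤ b → b ≤ d → b ≤ k → d - 2 * k ≤ b → p b + q b * d = v := by
    rw [hv]
    exact h.base_value hpq
  have plane : ∀ b, 0 ≤ b → b ≤ k → -k < d - b → d - b < k →
      p b + q b * (d + 2 * ((k + b - d + 1) / 2 : ℤ)) =
        v + ((k + b - d + 1) / 2 : ℤ) * Y ((k + b - d + 1) / 2) := by
    intro b h1 h2 h3 h4
    have := hE _ _ _ (d + 2 * ((k + b - d + 1) / 2)) (h.plane_nonneg b h1 h2 h3 h4)
      (by omega) (by omega)
    push_cast at this ⊢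
    rw [this, ← valY _ (by omega)]
  refine ⟨v, X, Y, base, valX, valY, ?_, ?_, ?_, ?_, ?_, ?_, ?_, ?_, ?_⟩
  · intro b t h1 h2 h3 h4
    have e1 := plane b h1 h3 (by omega) (by omega)
    have e2 := base b h1 h2 h3 (by omega)
    have hz : (((k + b - d + 1) / 2 : ℤ) : ℝ) ≠ 0 := by
      exact_mod_cast (by omega : (k + b - d + 1) / 2 ≠ 0)
    have e3 : 2 * q b = Y ((k + b - d + 1) / 2) :=
      mul_left_cancel₀ hz (by linear_combination e1 - e2)
    rw [← e3, ← e2]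
    ring
  · intro m t h1 h2 h3
    have e1 := plane (d + m) (by omega) h3 (by omega) (by omega)
    have e2 := valX m h1
    rw [show k + (d + m) - d + 1 = k + m + 1 by ring] at e1
    linear_combination (t - m) * e1 + (((k + m + 1) / 2 : ℤ) - t) * e2
  · intro y t h1 h2
    have e1 := hE _ _ _ (d + 2 * ((k - d + y + 1) / 2)) (h.plane_neg y h1 h2)
      (by omega) (by omega)
    rw [show (d + y + k + 1) / 2 = d + (k - d + y + 1) / 2 by omega] at e1
    push_cast at e1
    rw [valX _ (by omega)] at e1
    have e2 := valY y h1
    linear_combination (t - y) * e1 + (((k - d + y + 1) / 2 : ℤ) - t) * e2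
  · intro m h1 h2
    have e1 := hE _ _ _ (d + 2 * m) (h.over_lo m h1 h2) (by omega) (by omega)
    push_cast at e1
    rw [← e1, valX m h1]
  · intro m h1 h2 h3
    have e1 := hE _ _ _ (d + 2 * m) (h.over_hi m h1 h2 h3) (by omega) (by omega)
    push_cast at e1
    rw [← e1, valX m h1]
  · intro y h1 h2 h3 h4 h5
    have e1 := hE _ _ _ (d + 2 * y) (h.under_lo y h1 h2 h3 h4 h5) (by omega) (by omega)
    push_cast at e1
    rw [← e1, valY y h1]
  · intro h0
    have e1 := hE _ _ _ (d + 2 * 1) (h.under_one h0) (by omega) (by omega)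
    have e2 := valY 1 le_rfl
    push_cast at e1 e2
    linear_combination e1 - e2
  · intro y h1 h2 h3 h4
    have e1 := hE _ _ _ (d + 2 * y) (h.under_hi y h1 h2 h3 h4) (by omega) (by omega)
    push_cast at e1
    rw [← e1, valY y h1]
  · intro hdk
    rcases h.close hdk with hc | ⟨h2, hc⟩
    · left
      have e1 := hE _ _ _ (d + 2 * (k - d)) hc (by omega) (by omega)
      have e2 := valX (k - d) (by omega)
      have e3 := valY (k - d) (by omega)
      have hN : ((k - d : ℤ) : ℝ) ≠ 0 := by exact_mod_cast (by omega : k - d ≠ 0)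
      rw [show d + (k - d) = k by ring] at e2
      rw [neg_sub] at e3
      push_cast at e1 e2 e3 hN
      exact mul_left_cancel₀ hN (by linear_combination e1 - e2 + e3)
    · right
      refine ⟨h2, ?_⟩
      have e1 := hE _ _ _ (d + 2 * k) hc (by omega) (by omega)
      have e2 := plane d hd (by omega) (by omega) (by omega)
      have e3 := base d hd le_rfl (by omega) (by omega)
      rw [show k + d - d + 1 = k + 1 by ring] at e2
      have hz : (((k + 1) / 2 : ℤ) : ℝ) ≠ 0 := by
        exact_mod_cast (by omega : (k + 1) / 2 ≠ 0)
      have e4 : 2 * q d = Y ((k + 1) / 2) :=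
        mul_left_cancel₀ hz (by linear_combination e2 - e3)
      push_cast at e1
      rw [e1, ← e4, ← e3]
      ring

namespace SpreadValues

variable {k d : ℤ} {p q X Y : ℤ → ℝ} {v : ℝ}

lemma eq_of_mid (h : SpreadValues k d p q v X Y) {y b : ℤ} (hy : 1 ≤ y) (h1 : 0 ≤ b) (h2 : b ≤ d)
    (h3 : b ≤ k) (h4 : d - k < b) (hb : v + y * Y y = p b + q b * (d + 2 * y)) :
    Y y = Y ((k + b - d + 1) / 2) := by
  rw [h.fib_mid b y h1 h2 h3 h4] at hb
  have hy0 : (y : ℝ) ≠ 0 := by exact_mod_cast (by omega : y ≠ 0)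
  exact mul_left_cancel₀ hy0 (by linear_combination hb)

lemma line_of_over (h : SpreadValues k d p q v X Y) {y m : ℤ} (h1 : 1 ≤ m) (h2 : m < k)
    (h3 : d + m ≤ k) (hb : v + y * Y y = p (d + m) + q (d + m) * (d + 2 * y)) :
    (((k + m + 1) / 2 : ℤ) - m) * (y * Y y) =
      (((k + m + 1) / 2 : ℤ) - y) * (m * X m) +
        (y - m : ℝ) * (((k + m + 1) / 2 : ℤ) * Y ((k + m + 1) / 2)) := by
  have := h.fib_over m y h1 h2 h3
  rw [← hb] at this
  linear_combination this

lemma line_of_under (h : SpreadValues k d p q v X Y) {y m : ℤ} (h1 : 1 ≤ y) (h2 : y < k - d)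
    (hb : v + m * X m = p (-y) + q (-y) * (d + 2 * m)) :
    (((k - d + y + 1) / 2 : ℤ) - y) * (m * X m) =
      (((k - d + y + 1) / 2 : ℤ) - m) * (y * Y y) +
        (m - y : ℝ) * (((k - d + y + 1) / 2 : ℤ) * X ((k - d + y + 1) / 2)) := by
  have := h.fib_under y m h1 h2
  rw [← hb] at this
  linear_combination this

lemma twoPole (h : SpreadValues k d p q v X Y) (hk : 3 ≤ k) (hd : 0 ≤ d) (hdk : d < k) :
    TwoPole (k - d) k ((2 * (k - d) + 2) / 3) ((2 * k - d + 2) / 3) X Y where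
  one_le_μ := by omega
  one_le_ν := by omega
  innerY y h1 h2 := by
    obtain ⟨b, b1, b2, b3, hb⟩ : ∃ b, 0 ≤ b ∧ b ≤ k ∧
        (b = (d + y + 1) / 2 ∧ (d ≠ 0 ∨ y ≠ 1) ∨ b = 0 ∧ d = 0 ∧ y = 1) ∧
        v + y * Y y = p b + q b * (d + 2 * y) := by
      by_cases h0 : d = 0 ∧ y = 1
      · obtain ⟨h0, rfl⟩ := h0
        exact ⟨0, le_rfl, by omega, Or.inr ⟨rfl, h0, rfl⟩, by simpa using h.under_one h0⟩
      · exact ⟨_, by omega, by omega, Or.inl ⟨rfl, by omega⟩,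
          h.under_lo y h1 h2 (by omega) (by omega) (by omega)⟩
    rcases le_or_gt b d with hbd | hbd
    · refine ⟨(k + b - d + 1) / 2, 1, 0, by omega, by omega, le_rfl, by omega, le_rfl,
        one_pos, ?_⟩
      rw [h.eq_of_mid h1 b1 hbd b2 (by omega) hb]
      ring
    · obtain ⟨m, rfl⟩ : ∃ m, b = d + m := ⟨b - d, by ring⟩
      have hz : (0 : ℝ) < ((k + m + 1) / 2 : ℤ) - m := by
        exact_mod_cast (by omega : 0 < (k + m + 1) / 2 - m)
      have hy : (0 : ℝ) < y := by exact_mod_cast h1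
      have hm : (1 : ℝ) ≤ m := by exact_mod_cast (by omega : 1 ≤ m)
      have hmy : (m : ℝ) < y := by exact_mod_cast (by omega : m < y)
      have hzy : (y : ℝ) ≤ ((k + m + 1) / 2 : ℤ) := by
        exact_mod_cast (by omega : y ≤ (k + m + 1) / 2)
      refine ⟨_, m, _, ?_, ?_, ?_, ?_, ?_, ?_, eq_mean_of_line hy.ne' hz.ne'
        (h.line_of_over (by omega) (by omega) (by omega) hb)⟩
      · omega
      · omega
      · omega
      · omega
      · have : (0 : ℝ) ≤ ((k + m + 1) / 2 : ℤ) - y := by linarith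
        positivity
      · rw [div_lt_one (by positivity)]
        nlinarith
  innerX m h1 h2 := by
    have hb := h.over_lo m h1 h2
    obtain ⟨y, hy⟩ : ∃ y, y = (m + 1) / 2 := ⟨_, rfl⟩
    rw [← hy] at hb
    have hz : (0 : ℝ) < ((k - d + y + 1) / 2 : ℤ) - y := by
      exact_mod_cast (by omega : 0 < (k - d + y + 1) / 2 - y)
    have hy : (0 : ℝ) < y := by exact_mod_cast (by omega : 0 < y)
    have hm : (0 : ℝ) < m := by exact_mod_cast (by omega : 0 < m)
    have hmy : (y : ℝ) ≤ m := by exact_mod_cast (by omega : y ≤ m)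
    have hzy : (m : ℝ) < ((k - d + y + 1) / 2 : ℤ) := by
      exact_mod_cast (by omega : m < (k - d + y + 1) / 2)
    refine ⟨_, y, _, ?_, ?_, ?_, ?_, ?_, ?_, eq_mean_of_line hm.ne' hz.ne'
      (h.line_of_under (by omega) (by omega) hb)⟩
    · omega
    · omega
    · omega
    · omega
    · have : (0 : ℝ) < ((k - d + y + 1) / 2 : ℤ) - m := by linarith
      positivity
    · rw [div_le_one (by positivity)]
      nlinarith
  outerY y h1 h2 := by
    have hb := h.under_hi y (by omega) h1 h2 (by omega)
    obtain ⟨b, hbe⟩ : ∃ b, b = (d + y) / 2 := ⟨_, rfl⟩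
    rw [← hbe] at hb
    rcases le_or_gt b d with hbd | hbd
    · refine ⟨(k + b - d + 1) / 2, 1, 0, by omega, by omega, le_rfl, by omega, le_rfl, ?_⟩
      rw [h.eq_of_mid (by omega) (by omega) hbd (by omega) (by omega) hb]
      ring
    · obtain ⟨m, rfl⟩ : ∃ m, b = d + m := ⟨b - d, by ring⟩
      have hz : (0 : ℝ) < ((k + m + 1) / 2 : ℤ) - m := by
        exact_mod_cast (by omega : 0 < (k + m + 1) / 2 - m)
      have hy : (0 : ℝ) < y := by exact_mod_cast (by omega : 0 < y)
      have hm : (1 : ℝ) ≤ m := by exact_mod_cast (by omega : 1 ≤ m)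
      have hzy : (((k + m + 1) / 2 : ℤ) : ℝ) ≤ y := by
        exact_mod_cast (by omega : (k + m + 1) / 2 ≤ y)
      refine ⟨_, m, _, ?_, ?_, ?_, ?_, ?_, eq_extrapolation_of_line hy.ne' hz.ne'
        (h.line_of_over (by omega) (by omega) (by omega) hb)⟩
      · omega
      · omega
      · omega
      · omega
      · have : (0 : ℝ) ≤ y - ((k + m + 1) / 2 : ℤ) := by linarith
        positivity
  outerX m h1 h2 := by
    have hb := h.over_hi m (by omega) h1 (by omega)
    obtain ⟨y, hye⟩ : ∃ y, y = m / 2 := ⟨_, rfl⟩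
    rw [← hye] at hb
    have hz : (0 : ℝ) < ((k - d + y + 1) / 2 : ℤ) - y := by
      exact_mod_cast (by omega : 0 < (k - d + y + 1) / 2 - y)
    have hy : (0 : ℝ) < y := by exact_mod_cast (by omega : 0 < y)
    have hm : (0 : ℝ) < m := by exact_mod_cast (by omega : 0 < m)
    have hzy : (((k - d + y + 1) / 2 : ℤ) : ℝ) ≤ m := by
      exact_mod_cast (by omega : (k - d + y + 1) / 2 ≤ m)
    refine ⟨_, y, _, ?_, ?_, ?_, ?_, ?_, eq_extrapolation_of_line hm.ne' hz.ne'
      (h.line_of_under (by omega) (by omega) hb)⟩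
    · omega
    · omega
    · omega
    · omega
    · have : (0 : ℝ) ≤ m - ((k - d + y + 1) / 2 : ℤ) := by linarith
      positivity

lemma poles_eq (h : SpreadValues k d p q v X Y) (hk : 3 ≤ k) (hd : 0 ≤ d) (hdk : d < k) :
    X ((2 * (k - d) + 2) / 3) = Y ((2 * k - d + 2) / 3) := by
  have hT := h.twoPole hk hd hdk
  rcases h.close hdk with hc | ⟨h2, hc⟩
  · exact hT.poles_eq_of_eq (by omega) le_rfl (by omega) hc
  have hl := h.fib_over (k - d) k (by omega) (by omega) (by omega)
  rw [show d + (k - d) = k by ring, hc, add_sub_cancel_left] at hl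
  obtain ⟨w, hw⟩ : ∃ w, w = (k + (k - d) + 1) / 2 := ⟨_, rfl⟩
  rw [← hw] at hl
  have hz : (0 : ℝ) < w - (k - d : ℤ) := by exact_mod_cast (by omega : 0 < w - (k - d))
  have hk0 : (0 : ℝ) < k := by exact_mod_cast (by omega : 0 < k)
  have hN : (0 : ℝ) < (k - d : ℤ) := by exact_mod_cast (by omega : 0 < k - d)
  have hkw : (0 : ℝ) < k - w := by exact_mod_cast (by omega : 0 < k - w)
  refine hT.poles_eq_of_extrapolation (n := k - d) (w := w) (z := (k + 1) / 2) (by omega) le_rfl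
    (by omega) (by omega) (by omega) ?_ (by positivity)
    (eq_extrapolation_of_line hk0.ne' hz.ne' hl)
  rcases le_or_gt ((k + 1) / 2) ((2 * k - d + 2) / 3) with hy | hy
  · exact Or.inl hy
  refine Or.inr (eq_of_chain (K := d + 1) (fun y h1 h3 => ?_) _ hy.le (by omega))
  exact ⟨_, by omega, by omega, h.eq_of_mid (by omega) (by omega) (by omega) (by omega)
    (by omega) (h.under_hi y (by omega) h1 (by omega) (by omega))⟩

/-- All slopes agree. -/
lemma exists_slope (h : SpreadValues k d p q v X Y) (hk : 3 ≤ k) (hd : 0 ≤ d) (hd2 : d < 2 * k) :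
    ∃ c, (∀ m, 1 ≤ m → m ≤ k - d → X m = c) ∧
      (∀ y, 1 ≤ y → y ≤ k → y ≤ 2 * k - d → Y y = c) := by
  refine ⟨Y ((2 * k - d + 2) / 3), ?_⟩
  rcases lt_or_ge d k with hdk | hdk
  · have := (h.twoPole hk hd hdk).eq_of_poles (h.poles_eq hk hd hdk)
    exact ⟨this.1, fun y h1 h2 _ => this.2 y h1 h2⟩
  refine ⟨fun m h1 h2 => by omega, fun y h1 _ h2 => ?_⟩
  rcases le_total ((2 * k - d + 2) / 3) y with hy | hy
  · refine eq_of_chain (K := 2 * k - d) (fun y h1 h2 => ?_) y hy h2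
    exact ⟨_, by omega, by omega, h.eq_of_mid (by omega) (by omega) (by omega) (by omega)
      (by omega) (h.under_hi y (by omega) h1 (by omega) h2)⟩
  · have := eq_of_chain (K := -1) (ν := -((2 * k - d + 2) / 3)) (Y := fun y => Y (-y))
      (fun y h1 h2 => ?_) (-y) (by omega) (by omega)
    · simpa using this
    have := h.eq_of_mid (by omega) (by omega) (by omega) (by omega) (by omega)
      (h.under_lo (-y) (by omega) (by omega) (by omega) (by omega) (by omega))
    exact ⟨-((k + (d + -y + 1) / 2 - d + 1) / 2), by omega, by omega, by rw [neg_neg]; exact this⟩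

end SpreadValues

lemma SpreadEdges.rigid {k d : ℤ} (hk : 3 ≤ k) (hd : 0 ≤ d) {S : Set (ℤ × ℤ × ℤ)}
    (hS : SpreadEdges k d S) : Rigid k d S := by
  intro p q hpq
  rcases le_or_gt (2 * k) d with hd2 | hd2
  · refine ⟨p ((d + 1) / 3) + q ((d + 1) / 3) * d, 0, fun a b c ha hb hc habc => ?_⟩
    simp only [abs_le] at ha hb hc
    have hl : label a b c = d := by
      simp only [label, abs_eq_max_neg]
      omega
    rw [hl, hS.base_value hpq a (by omega) (by omega) (by omega) (by omega), zero_mul, add_zero]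
  obtain ⟨v, X, Y, h⟩ := hS.exists_values hk hd hd2 hpq
  obtain ⟨s, hX, hY⟩ := h.exists_slope hk hd hd2
  refine ⟨v - s * d / 2, s / 2, fun a b c ha hb hc habc => ?_⟩
  obtain ⟨t, ht⟩ : ∃ t : ℝ, t = (label a b c - d : ℝ) / 2 := ⟨_, rfl⟩
  have hlab : (label a b c : ℝ) = d + 2 * t := by rw [ht]; ring
  have ht' : ∀ n : ℤ, label a b c = d + 2 * n → t = n := by
    intro n hn
    rw [ht, hn]
    push_cast
    ring
  rw [hlab]
  suffices p a + q a * (d + 2 * t) = v + t * s by rw [this]; ring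
  simp only [abs_le] at ha hb hc
  simp only [label, abs_eq_max_neg] at ht'
  rcases lt_or_ge a 0 with ha0 | ha0
  · obtain ⟨y, rfl⟩ : ∃ y, a = -y := ⟨-a, by ring⟩
    rcases lt_or_ge y (k - d) with hy | hy
    · have e := h.fib_under y t (by omega) hy
      rw [hX _ (by omega) (by omega), hY y (by omega) (by omega) (by omega)] at e
      have hz : (((k - d + y + 1) / 2 : ℤ) : ℝ) - y ≠ 0 := by
        exact_mod_cast (by omega : (k - d + y + 1) / 2 - y ≠ 0)
      exact sub_eq_zero.1 (mul_left_cancel₀ hz (by linear_combination e))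
    · rw [ht' y (by omega), h.valY y (by omega), hY y (by omega) (by omega) (by omega)]
  rcases le_or_gt a d with had | had
  · rcases le_or_gt a (d - k) with hak | hak
    · have := h.base a ha0 had (by omega) (by omega)
      rw [ht' 0 (by omega)]
      simpa using this
    · rw [h.fib_mid a t ha0 had (by omega) hak, hY _ (by omega) (by omega) (by omega)]
  obtain ⟨m, rfl⟩ : ∃ m, a = d + m := ⟨a - d, by ring⟩
  rcases lt_or_ge m k with hm | hm
  · have e := h.fib_over m t (by omega) hm (by omega)
    rw [hX _ (by omega) (by omega), hY _ (by omega) (by omega) (by omega)] at e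
    have hz : (((k + m + 1) / 2 : ℤ) : ℝ) - m ≠ 0 := by
      exact_mod_cast (by omega : (k + m + 1) / 2 - m ≠ 0)
    exact sub_eq_zero.1 (mul_left_cancel₀ hz (by linear_combination e))
  · rw [ht' m (by omega), h.valX m (by omega), hX m (by omega) (by omega)]

/-- The second index of the edge at `b` in degree `d ≥ 0` whose triple has balanced remaining part.
With `η` set, the edge `{0, 2}` in degree `4` is replaced by `{0, 1}`. -/
def rowMid (k : ℤ) (η : Bool) (d b : ℤ) : ℤ :=
  if η = true ∧ b = 0 ∧ d = 4 then 1
  else if b < -((2 * k - d + 2) / 3) ∨ d = 0 ∧ b = -1 ∨ 0 ≤ b ∧ b < (d + 1) / 3 ∨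
      d < b ∧ b < d + (2 * (k - d) + 2) / 3 then (d - b) / 2
  else (d - b + 1) / 2

def rowTriple (k : ℤ) (η : Bool) (x : ℤ × ℤ) : ℤ × ℤ × ℤ :=
  if 0 ≤ x.1 + x.2 then
    (x.1, rowMid k η (x.1 + x.2) x.1, x.2 - rowMid k η (x.1 + x.2) x.1)
  else (x.1, -rowMid k η (-(x.1 + x.2)) (-x.1), x.2 + rowMid k η (-(x.1 + x.2)) (-x.1))

def planeTriple (k : ℤ) (x : ℤ × ℤ) : ℤ × ℤ × ℤ :=
  if 0 ≤ x.1 + x.2 ∧ 0 ≤ x.1 ∨ x.1 + x.2 < 0 ∧ 0 < x.1 then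
    (x.1, -((k - x.2 + 1) / 2), x.2 + (k - x.2 + 1) / 2)
  else (x.1, (x.2 + k + 1) / 2, x.2 - (x.2 + k + 1) / 2)

def closeTriple (k j d : ℤ) : ℤ × ℤ × ℤ :=
  if 0 ≤ d then (if 2 ≤ d ∧ d ≤ j then (k, d, -k) else (k, d - k, 0))
  else (if 2 ≤ -d ∧ -d ≤ j then (-k, d, k) else (-k, d + k, 0))

/-- The pairs `(b, d - b)` for which `b` is a root of the tree of row edges in degree `d`. -/
noncomputable def rowRoots (k : ℤ) : Finset (ℤ × ℤ) :=
  (Finset.Icc (-3 * k) (3 * k)).image (fun d => ((d + 1) / 3, d - (d + 1) / 3)) ∪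
  ((Finset.Ioo (-k) (2 * k)).image
      (fun d => (-((2 * k - d + 2) / 3), d + (2 * k - d + 2) / 3)) ∪
    (Finset.Ioo (-2 * k) k).image (fun d => ((2 * k + d + 2) / 3, d - (2 * k + d + 2) / 3)))

noncomputable def rowPairs (k : ℤ) : Finset (ℤ × ℤ) :=
  (Finset.Icc (-k) k ×ˢ Finset.Icc (-2 * k) (2 * k)) \ rowRoots k

/-- The family of cosyzygies whose triples have balanced remaining part whenever possible. -/
noncomputable def minusFamily (k : ℤ) (η : Bool) (j : ℤ) : Multiset (ℤ × ℤ × ℤ) :=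
  (rowPairs k).val.map (rowTriple k η) +
  (Finset.Icc (-k) k ×ˢ Finset.Ioo (-k) k).val.map (planeTriple k) +
  (Finset.Ioo (-k) k).val.map (closeTriple k j)

lemma mem_rowPairs {k b e : ℤ} : (b, e) ∈ rowPairs k ↔
    -k ≤ b ∧ b ≤ k ∧ -2 * k ≤ e ∧ e ≤ 2 * k ∧
    (-3 * k ≤ b + e → b + e ≤ 3 * k → b ≠ (b + e + 1) / 3) ∧
    (-k < b + e → b + e < 2 * k → b ≠ -((2 * k - (b + e) + 2) / 3)) ∧
    (-2 * k < b + e → b + e < k → b ≠ (2 * k + (b + e) + 2) / 3) := by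
  simp only [rowPairs, rowRoots, Finset.mem_sdiff, Finset.mem_product, Finset.mem_union,
    Finset.mem_image, Finset.mem_Icc, Finset.mem_Ioo, Prod.mk.injEq, not_or, not_exists, not_and]
  constructor
  · rintro ⟨⟨⟨h1, h2⟩, h3, h4⟩, h5, h6, h7⟩
    refine ⟨h1, h2, h3, h4, fun a a' h => ?_, fun a a' h => ?_, fun a a' h => ?_⟩
    · exact h5 (b + e) ⟨a, a'⟩ h.symm (by omega)
    · exact h6 (b + e) ⟨a, a'⟩ h.symm (by omega)
    · exact h7 (b + e) ⟨a, a'⟩ h.symm (by omega)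
  · rintro ⟨h1, h2, h3, h4, h5, h6, h7⟩
    refine ⟨⟨⟨h1, h2⟩, h3, h4⟩, fun d hd h h' => ?_, fun d hd h h' => ?_, fun d hd h h' => ?_⟩
    · obtain rfl : d = b + e := by omega
      exact h5 hd.1 hd.2 h.symm
    · obtain rfl : d = b + e := by omega
      exact h6 hd.1 hd.2 h.symm
    · obtain rfl : d = b + e := by omega
      exact h7 hd.1 hd.2 h.symm

lemma minusFamily_valid {k j : ℤ} {η : Bool} (hk : 3 ≤ k) :
    ∀ t ∈ minusFamily k η j, |t.1| ≤ k ∧ |t.2.1| ≤ k ∧ |t.2.2| ≤ k ∧ t.1 ≠ t.2.1 := by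
  intro t ht
  simp only [minusFamily, Multiset.mem_add, Multiset.mem_map, Finset.mem_val, Prod.exists,
    mem_rowPairs, Finset.mem_product, Finset.mem_Icc, Finset.mem_Ioo] at ht
  simp only [abs_le]
  rcases ht with (⟨b, e, h, rfl⟩ | ⟨b, e, h, rfl⟩) | ⟨d, h, rfl⟩
  · have key : ∀ d b e : ℤ, 0 ≤ d → b + e = d → -k ≤ b → b ≤ k → -2 * k ≤ e → e ≤ 2 * k →
        b ≠ (d + 1) / 3 → (d < 2 * k → b ≠ -((2 * k - d + 2) / 3)) →
        (d < k → b ≠ (2 * k + d + 2) / 3) →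
        (-k ≤ rowMid k η d b ∧ rowMid k η d b ≤ k) ∧
          (-k ≤ e - rowMid k η d b ∧ e - rowMid k η d b ≤ k) ∧ b ≠ rowMid k η d b := by
      intro d b e _ _ _ _ _ _ _ _ _
      unfold rowMid
      split_ifs <;> omega
    obtain ⟨h1, h2, h3, h4, h5, h6, h7⟩ := h
    rw [rowTriple]
    dsimp only
    split_ifs with hs
    · have := key (b + e) b e hs rfl h1 h2 h3 h4 (by omega) (by omega) (by omega)
      exact ⟨by omega, this⟩
    · have := key (-(b + e)) (-b) (-e) (by omega) (by omega) (by omega) (by omega) (by omega)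
        (by omega) (by omega) (by omega) (by omega)
      dsimp only
      refine ⟨by omega, by omega, by omega, by omega⟩
  · rw [planeTriple]
    dsimp only
    split_ifs <;> dsimp only <;> omega
  · rw [closeTriple]
    split_ifs <;> dsimp only <;> omega

lemma row_mem_minusFamily {k j : ℤ} {η : Bool} {d b : ℤ} (hd : 0 ≤ d) (h1 : -k ≤ b) (h2 : b ≤ k)
    (h3 : -2 * k ≤ d - b) (h4 : d - b ≤ 2 * k) (h5 : b ≠ (d + 1) / 3)
    (h6 : d < 2 * k → b ≠ -((2 * k - d + 2) / 3)) (h7 : d < k → b ≠ (2 * k + d + 2) / 3) :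
    (b, rowMid k η d b, d - b - rowMid k η d b) ∈ minusFamily k η j ∧
      (d ≠ 0 → (-b, -rowMid k η d b, -(d - b - rowMid k η d b)) ∈ minusFamily k η j) := by
  simp only [minusFamily, Multiset.mem_add, Multiset.mem_map, Finset.mem_val, Prod.exists,
    mem_rowPairs]
  refine ⟨Or.inl (Or.inl ⟨b, d - b, ?_, ?_⟩), fun hd0 => Or.inl (Or.inl ⟨-b, -(d - b), ?_, ?_⟩)⟩
  · rw [add_sub_cancel]
    refine ⟨h1, h2, h3, h4, fun _ _ => h5, fun _ => h6, fun _ => h7⟩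
  · simp only [rowTriple, add_sub_cancel]
    rw [if_pos hd]
  · rw [show -b + -(d - b) = -d by ring]
    omega
  · simp only [rowTriple, show -b + -(d - b) = -d by ring, neg_neg]
    rw [if_neg (by omega)]
    simp only [Prod.mk.injEq, true_and]
    ring

lemma plane_mem_minusFamily {k j : ℤ} {η : Bool} {d b : ℤ} (hd : 0 ≤ d) (h1 : -k ≤ b) (h2 : b ≤ k)
    (h3 : -k < d - b) (h4 : d - b < k) (p : ℤ)
    (hp : p = if 0 ≤ b then -((k + b - d + 1) / 2) else (d - b + k + 1) / 2) :
    (b, p, d - b - p) ∈ minusFamily k η j ∧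
      (d ≠ 0 → (-b, -p, -(d - b - p)) ∈ minusFamily k η j) := by
  simp only [minusFamily, Multiset.mem_add, Multiset.mem_map, Finset.mem_val, Prod.exists,
    Finset.mem_product, Finset.mem_Icc, Finset.mem_Ioo]
  refine ⟨Or.inl (Or.inr ⟨b, d - b, by omega, ?_⟩),
    fun hd0 => Or.inl (Or.inr ⟨-b, -(d - b), by omega, ?_⟩)⟩
  · simp only [planeTriple]
    split_ifs at hp ⊢ <;> simp only [Prod.mk.injEq, true_and] <;> omega
  · simp only [planeTriple]
    split_ifs at hp ⊢ <;> simp only [Prod.mk.injEq, true_and] <;> omega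

lemma close_mem_minusFamily {k j : ℤ} {η : Bool} {d : ℤ} (hd : 0 ≤ d) (hdk : d < k) :
    (((k, d - k, 0) ∈ minusFamily k η j ∨ 2 ≤ d ∧ (k, d, -k) ∈ minusFamily k η j)) ∧
      (d ≠ 0 → ((-k, -(d - k), 0) ∈ minusFamily k η j ∨
        2 ≤ d ∧ (-k, -d, k) ∈ minusFamily k η j)) := by
  have h1 : closeTriple k j d ∈ minusFamily k η j :=
    Multiset.mem_add.2 (Or.inr (Multiset.mem_map_of_mem _ (by simp; omega)))
  have h2 : closeTriple k j (-d) ∈ minusFamily k η j :=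
    Multiset.mem_add.2 (Or.inr (Multiset.mem_map_of_mem _ (by simp; omega)))
  rw [closeTriple, if_pos hd] at h1
  constructor
  · split_ifs at h1 with hj
    · exact Or.inr ⟨hj.1, h1⟩
    · exact Or.inl h1
  · intro hd0
    rw [closeTriple, if_neg (by omega), neg_neg] at h2
    rw [neg_sub, sub_eq_neg_add]
    split_ifs at h2 with hj
    · exact Or.inr ⟨hj.1, h2⟩
    · exact Or.inl h2

lemma spreadEdges_of_mem {k d : ℤ} {η : Bool} {S : Set (ℤ × ℤ × ℤ)} (hk : 3 ≤ k) (hd : 0 ≤ d)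
    (hrow : ∀ b, -k ≤ b → b ≤ k → -2 * k ≤ d - b → d - b ≤ 2 * k → b ≠ (d + 1) / 3 →
      (d < 2 * k → b ≠ -((2 * k - d + 2) / 3)) → (d < k → b ≠ (2 * k + d + 2) / 3) →
      (b, rowMid k η d b, d - b - rowMid k η d b) ∈ S)
    (hplane : ∀ b p, -k ≤ b → b ≤ k → -k < d - b → d - b < k →
      (p = if 0 ≤ b then -((k + b - d + 1) / 2) else (d - b + k + 1) / 2) → (b, p, d - b - p) ∈ S)
    (hclose : d < k → (k, d - k, 0) ∈ S ∨ 2 ≤ d ∧ (k, d, -k) ∈ S) : SpreadEdges k d S where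
  base b h1 h2 h3 h4 h5 := by
    have hm := hrow b (by omega) h3 (by omega) (by omega) h5 (by omega) (by omega)
    refine ⟨_, ?_, ?_, ?_, ?_, ?_, hm⟩
    any_goals simp only [abs_eq_max_neg]
    all_goals
      unfold rowMid
      split_ifs <;> omega
  over_lo m h1 h2 := by
    have hm := hrow (d + m) (by omega) (by omega) (by omega) (by omega) (by omega) (by omega)
      (by omega)
    have e : rowMid k η d (d + m) = -((m + 1) / 2) := by
      unfold rowMid
      split_ifs <;> omega
    rw [e] at hm
    convert hm using 3
    omega
  over_hi m h1 h2 h3 := by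
    have hm := hrow (d + m) (by omega) (by omega) (by omega) (by omega) (by omega) (by omega)
      (by omega)
    have e : rowMid k η d (d + m) = -(m / 2) := by
      unfold rowMid
      split_ifs <;> omega
    rw [e] at hm
    convert hm using 3
    omega
  under_lo y h1 h2 h3 h4 h5 := by
    have hm := hrow (-y) (by omega) (by omega) (by omega) (by omega) (by omega) (by omega)
      (by omega)
    have e : rowMid k η d (-y) = (d + y + 1) / 2 := by
      unfold rowMid
      split_ifs <;> omega
    rw [e] at hm
    convert hm using 3
    omega
  under_one h0 := by
    have hm := hrow (-1) (by omega) (by omega) (by omega) (by omega) (by omega) (by omega)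
      (by omega)
    have e : rowMid k η d (-1) = 0 := by
      unfold rowMid
      split_ifs <;> omega
    rw [e] at hm
    convert hm using 3
    omega
  under_hi y h1 h2 h3 h4 := by
    have hm := hrow (-y) (by omega) (by omega) (by omega) (by omega) (by omega) (by omega)
      (by omega)
    have e : rowMid k η d (-y) = (d + y) / 2 := by
      unfold rowMid
      split_ifs <;> omega
    rw [e] at hm
    convert hm using 3
    omega
  plane_nonneg b h1 h2 h3 h4 := by
    have := hplane b _ (by omega) h2 h3 h4 rfl
    rw [if_pos h1] at this
    simpa using this
  plane_neg y h1 h2 := by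
    have := hplane (-y) _ (by omega) (by omega) (by omega) (by omega) rfl
    rw [if_neg (by omega)] at this
    simpa [sub_neg_eq_add] using this
  close := hclose

lemma minusFamily_rigid {k j : ℤ} {η : Bool} (hk : 3 ≤ k) (d : ℤ) :
    Rigid k d {t | t ∈ minusFamily k η j} := by
  rcases le_or_gt 0 d with hd | hd
  · refine (spreadEdges_of_mem (η := η) hk hd ?_ ?_ ?_).rigid hk hd
    · intro b h1 h2 h3 h4 h5 h6 h7
      exact (row_mem_minusFamily hd h1 h2 h3 h4 h5 h6 h7).1
    · intro b p h1 h2 h3 h4 hp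
      exact (plane_mem_minusFamily hd h1 h2 h3 h4 p hp).1
    · intro h
      exact (close_mem_minusFamily hd h).1
  · have hd' : 0 ≤ -d := by omega
    refine Rigid.reflect ((spreadEdges_of_mem (η := η) hk hd' ?_ ?_ ?_).rigid hk hd')
    · intro b h1 h2 h3 h4 h5 h6 h7
      exact (row_mem_minusFamily hd' h1 h2 h3 h4 h5 h6 h7).2 (by omega)
    · intro b p h1 h2 h3 h4 hp
      exact (plane_mem_minusFamily hd' h1 h2 h3 h4 p hp).2 (by omega)
    · intro h
      simpa using (close_mem_minusFamily (j := j) (η := η) hd' h).2 (by omega)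

lemma sum_Ico_add_one {a b : ℤ} (hab : a ≤ b) (g : ℤ → ℚ) :
    ∑ i ∈ Finset.Ico a (b + 1), g i = ∑ i ∈ Finset.Ico a b, g i + g b := by
  have : Finset.Ico a (b + 1) = insert b (Finset.Ico a b) := by
    ext i
    simp only [Finset.mem_Ico, Finset.mem_insert]
    omega
  rw [this, Finset.sum_insert (by simp), add_comm]

lemma sum_Icc_eq_Ico_add {a b : ℤ} (hab : a ≤ b) (g : ℤ → ℚ) :
    ∑ i ∈ Finset.Icc a b, g i = ∑ i ∈ Finset.Ico a b, g i + g b := by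
  rw [← sum_Ico_add_one hab]
  congr 1

lemma sum_Ico_succ_arg {a b : ℤ} (hab : a ≤ b) (g : ℤ → ℚ) :
    ∑ i ∈ Finset.Ico a b, g (i + 1) = ∑ i ∈ Finset.Ico a b, g i + g b - g a := by
  induction b, hab using Int.leInduction with
  | base => simp
  | succ b hb ih =>
    rw [sum_Ico_add_one hb, sum_Ico_add_one hb, ih]
    ring

lemma sum_Ico_shift (a b c : ℤ) (g : ℤ → ℚ) :
    ∑ i ∈ Finset.Ico a b, g (i + c) = ∑ i ∈ Finset.Ico (a + c) (b + c), g i := by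
  apply Finset.sum_nbij' (fun i => i + c) (fun i => i - c) <;> simp only [Finset.mem_Ico] <;>
    intros <;> first | omega | simp

lemma sum_Ico_two_mul {a b : ℤ} (hab : a ≤ b) (g : ℤ → ℚ) :
    ∑ i ∈ Finset.Ico (2 * a) (2 * b), g i =
      ∑ i ∈ Finset.Ico a b, (g (2 * i) + g (2 * i + 1)) := by
  induction b, hab using Int.leInduction with
  | base => simp
  | succ b hb ih =>
    rw [sum_Ico_add_one hb, show 2 * (b + 1) = 2 * b + 1 + 1 by ring,
      sum_Ico_add_one (by omega), sum_Ico_add_one (by omega), ih]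
    ring

lemma sum_Ico_three_mul {a b : ℤ} (hab : a ≤ b) (g : ℤ → ℚ) :
    ∑ i ∈ Finset.Ico (3 * a) (3 * b), g i =
      ∑ i ∈ Finset.Ico a b, (g (3 * i) + g (3 * i + 1) + g (3 * i + 2)) := by
  induction b, hab using Int.leInduction with
  | base => simp
  | succ b hb ih =>
    rw [sum_Ico_add_one hb, show 3 * (b + 1) = 3 * b + 1 + 1 + 1 by ring,
      sum_Ico_add_one (by omega), sum_Ico_add_one (by omega), sum_Ico_add_one (by omega), ih,
      add_assoc (3 * b)]
    norm_num
    ring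

lemma sum_Ioo_reflect {k : ℤ} (g : ℤ → ℚ) :
    ∑ i ∈ Finset.Ioo 0 k, g (k - i) = ∑ i ∈ Finset.Ioo 0 k, g i := by
  apply Finset.sum_nbij' (fun i => k - i) (fun i => k - i) <;> simp only [Finset.mem_Ioo] <;>
    intros <;> first | omega | simp

lemma sum_Ioo_fold {k : ℤ} (hk : 0 < k) (g : ℤ → ℚ) :
    ∑ i ∈ Finset.Ioo (-k) k, g i = g 0 + ∑ i ∈ Finset.Ioo 0 k, (g i + g (-i)) := by
  have : ∑ i ∈ Finset.Ioo (-k) 0, g i = ∑ i ∈ Finset.Ioo 0 k, g (-i) := by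
    apply Finset.sum_nbij' (fun i => -i) (fun i => -i) <;> simp only [Finset.mem_Ioo] <;>
      intros <;> first | omega | simp
  rw [sum_Ioo_split hk, this, Finset.sum_add_distrib]
  ring

lemma sum_rowPairs (k : ℤ) (g : ℤ × ℤ → ℚ) :
    ∑ x ∈ rowPairs k, g x =
      ∑ b ∈ Finset.Icc (-k) k, ∑ e ∈ Finset.Icc (-2 * k) (2 * k), g (b, e) -
      (∑ d ∈ Finset.Icc (-3 * k) (3 * k), g ((d + 1) / 3, d - (d + 1) / 3) +
      (∑ d ∈ Finset.Ioo (-k) (2 * k), g (-((2 * k - d + 2) / 3), d + (2 * k - d + 2) / 3) +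
      ∑ d ∈ Finset.Ioo (-2 * k) k, g ((2 * k + d + 2) / 3, d - (2 * k + d + 2) / 3))) := by
  have hsub : rowRoots k ⊆ Finset.Icc (-k) k ×ˢ Finset.Icc (-2 * k) (2 * k) := by
    rintro ⟨b, e⟩ hx
    simp only [rowRoots, Finset.mem_union, Finset.mem_image, Finset.mem_Icc, Finset.mem_Ioo,
      Prod.mk.injEq, Finset.mem_product] at hx ⊢
    rcases hx with ⟨d, h, rfl, rfl⟩ | ⟨d, h, rfl, rfl⟩ | ⟨d, h, rfl, rfl⟩ <;> omega
  rw [← Finset.sum_product', eq_sub_iff_add_eq, ← Finset.sum_sdiff hsub, rowPairs, rowRoots,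
    Finset.sum_union, Finset.sum_union, Finset.sum_image, Finset.sum_image, Finset.sum_image]
  · intro d _ d' _ h
    simp only [Prod.mk.injEq] at h
    omega
  · intro d _ d' _ h
    simp only [Prod.mk.injEq] at h
    omega
  · intro d _ d' _ h
    simp only [Prod.mk.injEq] at h
    omega
  · rw [Finset.disjoint_left]
    rintro ⟨b, e⟩ hx hx'
    simp only [Finset.mem_image, Finset.mem_Ioo, Prod.mk.injEq] at hx hx'
    obtain ⟨d, h, rfl, rfl⟩ := hx
    obtain ⟨d', h', h1, h2⟩ := hx'
    omega
  · rw [Finset.disjoint_left]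
    rintro ⟨b, e⟩ hx hx'
    simp only [Finset.mem_union, Finset.mem_image, Finset.mem_Ioo, Finset.mem_Icc,
      Prod.mk.injEq] at hx hx'
    obtain ⟨d, h, rfl, rfl⟩ := hx
    rcases hx' with ⟨d', h', h1, h2⟩ | ⟨d', h', h1, h2⟩ <;> omega

lemma minusFamily_card {k j : ℤ} {η : Bool} (hk : 3 ≤ k) :
    ((minusFamily k η j).card : ℤ) = 12 * k ^ 2 - 4 * k := by
  have h := sum_rowPairs k (fun _ => 1)
  simp only [Finset.sum_const, nsmul_eq_mul, mul_one, Int.card_Icc, Int.card_Ioo] at h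
  simp only [minusFamily, Multiset.card_add, Multiset.card_map, Finset.card_val,
    Finset.card_product, Int.card_Icc, Int.card_Ioo]
  have e1 : (((k + 1 - -k).toNat : ℕ) : ℤ) = 2 * k + 1 := by omega
  have e2 : (((2 * k + 1 - -2 * k).toNat : ℕ) : ℤ) = 4 * k + 1 := by omega
  have e3 : (((3 * k + 1 - -3 * k).toNat : ℕ) : ℤ) = 6 * k + 1 := by omega
  have e4 : (((2 * k - -k - 1).toNat : ℕ) : ℤ) = 3 * k - 1 := by omega
  have e5 : (((k - -2 * k - 1).toNat : ℕ) : ℤ) = 3 * k - 1 := by omega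
  have e6 : (((k - -k - 1).toNat : ℕ) : ℤ) = 2 * k - 1 := by omega
  have h' : ((rowPairs k).card : ℤ) = (((k + 1 - -k).toNat : ℕ) : ℤ) *
      (((2 * k + 1 - -2 * k).toNat : ℕ) : ℤ) - ((((3 * k + 1 - -3 * k).toNat : ℕ) : ℤ) +
      ((((2 * k - -k - 1).toNat : ℕ) : ℤ) + (((k - -2 * k - 1).toNat : ℕ) : ℤ))) := by
    exact_mod_cast h
  push_cast
  rw [h', e1, e2, e3, e4, e5, e6]
  ring

/-- The weight of a triple with first index `x.1` and balanced remaining part of sum `x.2`. -/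
def balancedWeight (R : ℤ → ℚ) (x : ℤ × ℤ) : ℚ := R x.1 + R (x.2 / 2) + R ((x.2 + 1) / 2)

lemma balancedWeight_eq {R : ℤ → ℚ} {b e m n : ℤ} (hm : e / 2 = m) (hn : (e + 1) / 2 = n) :
    balancedWeight R (b, e) = R b + R m + R n := by
  rw [balancedWeight, hm, hn]

section

variable {k : ℤ} {R : ℤ → ℚ}

lemma sum_balancedWeight (hk : 0 ≤ k) (hR : ∑ i ∈ Finset.Icc (-k) k, R i = 0) :
    ∑ b ∈ Finset.Icc (-k) k, ∑ e ∈ Finset.Icc (-2 * k) (2 * k), balancedWeight R (b, e) =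
      -(2 * k + 1) * (R k + R (-k)) := by
  have hcard : (((Finset.Icc (-k) k).card : ℤ) : ℚ) = 2 * k + 1 := by
    rw [Int.card_Icc, Int.toNat_of_nonneg (by omega)]
    push_cast
    ring
  have hh : ∑ e ∈ Finset.Icc (-2 * k) (2 * k), (R (e / 2) + R ((e + 1) / 2)) =
      -(R k + R (-k)) := by
    rw [sum_Icc_eq_Ico_add (by omega), show -2 * k = 2 * -k by ring, sum_Ico_two_mul (by omega)]
    rw [Finset.sum_congr rfl (g := fun i => 3 * R i + R (i + 1)) fun i _ => by
        rw [show 2 * i / 2 = i by omega, show (2 * i + 1) / 2 = i by omega,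
          show (2 * i + 1 + 1) / 2 = i + 1 by omega]
        ring,
      Finset.sum_add_distrib, sum_Ico_succ_arg (by omega), ← Finset.mul_sum,
      show 2 * k / 2 = k by omega, show (2 * k + 1) / 2 = k by omega]
    rw [sum_Icc_eq_Ico_add (by omega)] at hR
    linarith
  rw [Finset.sum_add_distrib] at hh
  simp only [balancedWeight, add_assoc, Finset.sum_add_distrib, Finset.sum_const, nsmul_eq_mul,
    hh, ← Finset.mul_sum, hR]
  push_cast at hcard
  rw [hcard]
  ring

lemma sum_balancedWeight_middle (hk : 0 ≤ k) (hR : ∑ i ∈ Finset.Icc (-k) k, R i = 0) :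
    ∑ d ∈ Finset.Icc (-3 * k) (3 * k), balancedWeight R ((d + 1) / 3, d - (d + 1) / 3) =
      -3 * (R k + R (-k)) := by
  rw [sum_Icc_eq_Ico_add (by omega), show -3 * k = 3 * -k by ring, sum_Ico_three_mul (by omega)]
  rw [Finset.sum_congr rfl (g := fun i => 6 * R i + 3 * R (i + 1)) fun i _ => by
      rw [balancedWeight_eq (m := i) (n := i) (by omega) (by omega),
        balancedWeight_eq (m := i) (n := i + 1) (by omega) (by omega),
        balancedWeight_eq (m := i) (n := i + 1) (by omega) (by omega),
        show (3 * i + 1) / 3 = i by omega, show (3 * i + 1 + 1) / 3 = i by omega,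
        show (3 * i + 2 + 1) / 3 = i + 1 by omega]
      ring,
    balancedWeight_eq (m := k) (n := k) (by omega) (by omega),
    show (3 * k + 1) / 3 = k by omega,
    Finset.sum_add_distrib, ← Finset.mul_sum, ← Finset.mul_sum, sum_Ico_succ_arg (by omega)]
  rw [sum_Icc_eq_Ico_add (by omega)] at hR
  linarith

lemma sum_Ioo_eq_Ico_sub {a b : ℤ} (hab : a < b) (g : ℤ → ℚ) :
    ∑ i ∈ Finset.Ioo a b, g i = ∑ i ∈ Finset.Ico a b, g i - g a := by
  rw [sum_Ico_of_lt hab]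
  ring

lemma sum_Ico_sub_arg (k : ℤ) (g : ℤ → ℚ) :
    ∑ i ∈ Finset.Ico 0 k, g (i - k) = ∑ i ∈ Finset.Ico (-k) 0, g i := by
  simpa [sub_eq_add_neg] using sum_Ico_shift 0 k (-k) g

lemma sum_balancedWeight_lower (hk : 0 < k) :
    ∑ d ∈ Finset.Ioo (-k) (2 * k),
        balancedWeight R (-((2 * k - d + 2) / 3), d + (2 * k - d + 2) / 3) =
      3 * ∑ i ∈ Finset.Ico (-k) 0, R i + 6 * ∑ i ∈ Finset.Ico 0 k, R i +
        3 * R k - 5 * R 0 - R (-k) := by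
  have h := sum_Ico_shift (3 * 0) (3 * k) (-k) fun d =>
    balancedWeight R (-((2 * k - d + 2) / 3), d + (2 * k - d + 2) / 3)
  rw [show 3 * 0 + -k = -k by ring, show 3 * k + -k = 2 * k by ring,
    sum_Ico_three_mul hk.le] at h
  rw [sum_Ioo_eq_Ico_sub (by omega), ← h]
  rw [Finset.sum_congr rfl (g := fun i => 3 * R (i - k) + 3 * R i + 3 * R (i + 1)) fun i _ => by
      rw [balancedWeight_eq (m := i) (n := i) (by omega) (by omega),
        balancedWeight_eq (m := i) (n := i + 1) (by omega) (by omega),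
        balancedWeight_eq (m := i + 1) (n := i + 1) (by omega) (by omega),
        show -((2 * k - (3 * i + -k) + 2) / 3) = i - k by omega,
        show -((2 * k - (3 * i + 1 + -k) + 2) / 3) = i - k by omega,
        show -((2 * k - (3 * i + 2 + -k) + 2) / 3) = i - k by omega]
      ring,
    balancedWeight_eq (m := 0) (n := 0) (by omega) (by omega),
    show -((2 * k - -k + 2) / 3) = -k by omega, Finset.sum_add_distrib, Finset.sum_add_distrib,
    ← Finset.mul_sum, ← Finset.mul_sum, ← Finset.mul_sum, sum_Ico_succ_arg hk.le,
    sum_Ico_sub_arg]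
  ring

lemma sum_balancedWeight_upper (hk : 0 < k) :
    ∑ d ∈ Finset.Ioo (-2 * k) k,
        balancedWeight R ((2 * k + d + 2) / 3, d - (2 * k + d + 2) / 3) =
      6 * ∑ i ∈ Finset.Ico (-k) 0, R i + 3 * ∑ i ∈ Finset.Ico 0 k, R i +
        2 * R k - 2 * R 0 - 3 * R (-k) := by
  have h := sum_Ico_shift (3 * 0) (3 * k) (-2 * k) fun d =>
    balancedWeight R ((2 * k + d + 2) / 3, d - (2 * k + d + 2) / 3)
  rw [show 3 * 0 + -2 * k = -2 * k by ring, show 3 * k + -2 * k = k by ring,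
    sum_Ico_three_mul hk.le] at h
  rw [sum_Ioo_eq_Ico_sub (by omega), ← h]
  have h1 := sum_Ico_sub_arg k fun i => R (i + 1)
  rw [sum_Ico_succ_arg (by omega)] at h1
  rw [Finset.sum_congr rfl
      (g := fun i => R i + 2 * R (i + 1) + 5 * R (i - k) + R (i - k + 1)) fun i _ => by
      rw [balancedWeight_eq (m := i - k) (n := i - k) (by omega) (by omega),
        balancedWeight_eq (m := i - k) (n := i - k) (by omega) (by omega),
        balancedWeight_eq (m := i - k) (n := i - k + 1) (by omega) (by omega),
        show (2 * k + (3 * i + -2 * k) + 2) / 3 = i by omega,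
        show (2 * k + (3 * i + 1 + -2 * k) + 2) / 3 = i + 1 by omega,
        show (2 * k + (3 * i + 2 + -2 * k) + 2) / 3 = i + 1 by omega]
      ring,
    balancedWeight_eq (m := -k) (n := -k) (by omega) (by omega),
    show (2 * k + -2 * k + 2) / 3 = 0 by omega, Finset.sum_add_distrib, Finset.sum_add_distrib,
    Finset.sum_add_distrib, ← Finset.mul_sum, ← Finset.mul_sum, sum_Ico_succ_arg hk.le,
    sum_Ico_sub_arg, h1]
  ring

lemma sum_Icc_eq_blocks (hk : 0 < k) :
    ∑ i ∈ Finset.Icc (-k) k, R i =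
      ∑ i ∈ Finset.Ico (-k) 0, R i + ∑ i ∈ Finset.Ico 0 k, R i + R k := by
  rw [sum_Icc_of_lt (by omega), sum_Ioo_split hk, sum_Ico_of_lt (by omega), sum_Ico_of_lt hk]
  ring

lemma sum_rowPairs_balancedWeight (hk : 0 < k) (hR : ∑ i ∈ Finset.Icc (-k) k, R i = 0) :
    ∑ x ∈ rowPairs k, balancedWeight R x = 7 * R 0 + (6 - 2 * k) * (R k + R (-k)) := by
  rw [sum_rowPairs, sum_balancedWeight hk.le hR, sum_balancedWeight_middle hk.le hR,
    sum_balancedWeight_lower hk, sum_balancedWeight_upper hk]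
  rw [sum_Icc_eq_blocks hk] at hR
  linarith

lemma wt_rowTriple {η : Bool} (x : ℤ × ℤ) : wt R (rowTriple k η x) =
    balancedWeight R x + (if x = (0, 4) then if η then R 1 + R 3 - 2 * R 2 else 0 else 0) +
      (if x = (0, -4) then if η then R (-1) + R (-3) - 2 * R (-2) else 0 else 0) := by
  have key : ∀ (T : ℤ → ℚ) (d b : ℤ),
      T (rowMid k η d b) + T (d - b - rowMid k η d b) = T ((d - b) / 2) + T ((d - b + 1) / 2) +
        (if b = 0 ∧ d = 4 then if η then T 1 + T 3 - 2 * T 2 else 0 else 0) := by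
    intro T d b
    unfold rowMid
    by_cases h : b = 0 ∧ d = 4
    · obtain ⟨rfl, rfl⟩ := h
      cases η
      · norm_num
      · norm_num
        ring
    · rw [if_neg (by tauto), if_neg h, add_zero]
      split_ifs
      · rw [show d - b - (d - b) / 2 = (d - b + 1) / 2 by omega]
      · rw [show d - b - (d - b + 1) / 2 = (d - b) / 2 by omega, add_comm]
  obtain ⟨b, e⟩ := x
  simp only [wt, rowTriple, balancedWeight, Prod.mk.injEq]
  by_cases hd : 0 ≤ b + e
  · have h := key R (b + e) b
    rw [add_sub_cancel_left] at h
    rw [if_pos hd, if_neg (c := b = 0 ∧ e = -4) (by omega)]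
    simp only [show b = 0 ∧ e = 4 ↔ b = 0 ∧ b + e = 4 by omega]
    linarith
  · have h := key (fun i => R (-i)) (-(b + e)) (-b)
    rw [show -(b + e) - -b = -e by ring, show -(-e / 2) = (e + 1) / 2 by omega,
      show -((-e + 1) / 2) = e / 2 by omega] at h
    rw [if_neg hd, if_neg (c := b = 0 ∧ e = 4) (by omega)]
    simp only [show b = 0 ∧ e = -4 ↔ -b = 0 ∧ -(b + e) = 4 by omega]
    rw [show -(-e - rowMid k η (-(b + e)) (-b)) = e + rowMid k η (-(b + e)) (-b) by ring] at h
    linarith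

lemma sum_rowTriple {η : Bool} (hk : 3 ≤ k) (hR : ∑ i ∈ Finset.Icc (-k) k, R i = 0) :
    ∑ x ∈ rowPairs k, wt R (rowTriple k η x) =
      7 * R 0 + (6 - 2 * k) * (R k + R (-k)) +
        if η then R 1 + R (-1) + (R 3 + R (-3)) - 2 * (R 2 + R (-2)) else 0 := by
  have h1 : ((0, 4) : ℤ × ℤ) ∈ rowPairs k := by rw [mem_rowPairs]; omega
  have h2 : ((0, -4) : ℤ × ℤ) ∈ rowPairs k := by rw [mem_rowPairs]; omega
  simp only [wt_rowTriple, Finset.sum_add_distrib, Finset.sum_ite_eq', if_pos h1, if_pos h2,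
    sum_rowPairs_balancedWeight (show 0 < k by omega) hR]
  cases η
  · simp
  · simp only [if_true]
    ring

lemma sum_planeTriple (hk : 0 < k) (hR : ∑ i ∈ Finset.Icc (-k) k, R i = 0) :
    ∑ x ∈ Finset.Icc (-k) k ×ˢ Finset.Ioo (-k) k, wt R (planeTriple k x) =
      -(2 * k + 1) * (2 * R 0 + R k + R (-k)) := by
  have hwt : ∀ x : ℤ × ℤ, wt R (planeTriple k x) =
      R x.1 + (R ((x.2 - k) / 2) + R ((x.2 + k + 1) / 2)) := by
    rintro ⟨b, e⟩
    simp only [wt, planeTriple]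
    split_ifs
    · dsimp only
      rw [show e + (k - e + 1) / 2 = (e + k + 1) / 2 by omega,
        show -((k - e + 1) / 2) = (e - k) / 2 by omega, add_assoc]
    · dsimp only
      rw [show e - (e + k + 1) / 2 = (e - k) / 2 by omega]
      ring
  have hcard : (((Finset.Icc (-k) k).card : ℤ) : ℚ) = 2 * k + 1 := by
    rw [Int.card_Icc, Int.toNat_of_nonneg (by omega)]
    push_cast
    ring
  have hh : ∑ e ∈ Finset.Ioo (-k) k, (R ((e - k) / 2) + R ((e + k + 1) / 2)) =
      -(2 * R 0 + R k + R (-k)) := by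
    have h := sum_Ico_shift (2 * 0) (2 * k) (-k) fun e => R ((e - k) / 2) + R ((e + k + 1) / 2)
    rw [show 2 * 0 + -k = -k by ring, show 2 * k + -k = k by ring, sum_Ico_two_mul hk.le] at h
    rw [sum_Ioo_eq_Ico_sub (by omega), ← h]
    rw [Finset.sum_congr rfl (g := fun i => 2 * R (i - k) + R i + R (i + 1)) fun i _ => by
        rw [show (2 * i + -k - k) / 2 = i - k by omega,
          show (2 * i + 1 + -k - k) / 2 = i - k by omega,
          show (2 * i + -k + k + 1) / 2 = i by omega,
          show (2 * i + 1 + -k + k + 1) / 2 = i + 1 by omega]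
        ring,
      Finset.sum_add_distrib, Finset.sum_add_distrib, ← Finset.mul_sum, sum_Ico_succ_arg hk.le,
      sum_Ico_sub_arg, show (-k - k) / 2 = -k by omega, show (-k + k + 1) / 2 = 0 by omega]
    rw [sum_Icc_eq_blocks hk] at hR
    linarith
  rw [Finset.sum_product]
  simp only [hwt, Finset.sum_add_distrib, Finset.sum_const, nsmul_eq_mul, ← Finset.mul_sum, hR]
  rw [Finset.sum_add_distrib] at hh
  rw [← mul_add, hh]
  push_cast at hcard
  rw [hcard]
  ring

lemma sum_closeTriple (hk : 0 < k) {j : ℤ} (hj : j < k)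
    (hR : ∑ i ∈ Finset.Icc (-k) k, R i = 0) :
    ∑ d ∈ Finset.Ioo (-k) k, wt R (closeTriple k j d) =
      (k - 1) * (R k + R (-k) + 2 * R 0) +
        ∑ d ∈ Finset.Icc 2 j,
          (R k + R (-k) - 2 * R 0 + (R d + R (-d)) - (R (k - d) + R (-(k - d)))) := by
  have hcard : (((Finset.Ioo 0 k).card : ℤ) : ℚ) = k - 1 := by
    rw [Int.card_Ioo, Int.toNat_of_nonneg (by omega)]
    push_cast
    ring
  have h0 : wt R (closeTriple k j 0) = R 0 + R k + R (-k) := by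
    simp only [wt, closeTriple]
    norm_num
    ring
  have hf : ∀ d ∈ Finset.Ioo 0 k, wt R (closeTriple k j d) + wt R (closeTriple k j (-d)) =
      (R k + R (-k) + 2 * R 0) + (R (k - d) + R (-(k - d))) +
        if 2 ≤ d ∧ d ≤ j then
          R k + R (-k) - 2 * R 0 + (R d + R (-d)) - (R (k - d) + R (-(k - d))) else 0 := by
    intro d hd
    rw [Finset.mem_Ioo] at hd
    simp only [wt, closeTriple, neg_neg]
    rw [if_pos (c := 0 ≤ d) (by omega), if_neg (c := 0 ≤ -d) (by omega)]
    split_ifs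
    · ring
    · dsimp only
      rw [show d - k = -(k - d) by ring, show -d + k = k - d by ring]
      ring
  have hset : (Finset.Ioo 0 k).filter (fun d => 2 ≤ d ∧ d ≤ j) = Finset.Icc 2 j := by
    ext d
    simp only [Finset.mem_filter, Finset.mem_Ioo, Finset.mem_Icc]
    omega
  rw [sum_Ioo_fold hk, h0, Finset.sum_congr rfl hf, Finset.sum_add_distrib,
    Finset.sum_add_distrib, ← Finset.sum_filter, hset,
    sum_Ioo_reflect (fun i => R i + R (-i)), Finset.sum_const, nsmul_eq_mul]
  rw [sum_Icc_of_lt (by omega), sum_Ioo_fold hk] at hR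
  push_cast at hcard
  rw [hcard]
  linarith

lemma minusFamily_weight {η : Bool} {j : ℤ} (hk : 3 ≤ k) (hj : j < k)
    (hR : ∑ i ∈ Finset.Icc (-k) k, R i = 0) :
    ((minusFamily k η j).map (wt R)).sum =
      -(2 * k - 3) * (R 0 + R k + R (-k)) - (k - 1) * (R k + R (-k)) +
      ∑ d ∈ Finset.Icc 2 j,
        (R k + R (-k) - 2 * R 0 + (R d + R (-d)) - (R (k - d) + R (-(k - d)))) +
      if η then R 1 + R (-1) + (R 3 + R (-3)) - 2 * (R 2 + R (-2)) else 0 := by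
  simp only [minusFamily, Multiset.map_add, Multiset.map_map, Multiset.sum_add, Function.comp_def]
  change ∑ x ∈ _, _ + ∑ x ∈ _, _ + ∑ x ∈ _, _ = _
  rw [sum_rowTriple hk hR, sum_planeTriple (by omega) hR, sum_closeTriple (by omega) hj hR]
  ring

end

lemma sum_Icc_two_reflect (k : ℤ) (g : ℤ → ℚ) :
    ∑ d ∈ Finset.Icc 2 (k - 2), (g d - g (k - d)) = 0 := by
  rw [Finset.sum_sub_distrib, sub_eq_zero]
  apply Finset.sum_nbij' (fun i => k - i) (fun i => k - i) <;> simp only [Finset.mem_Icc] <;>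
    intros <;> first | omega | simp

/-- When `R 0 + R k + R (-k) < 0`, a suitable choice of parameters makes the weight of
`minusFamily` non-negative. -/
lemma exists_minusFamily_weight_nonneg {k : ℤ} {R : ℤ → ℚ} (hk : 3 ≤ k)
    (hR : ∑ i ∈ Finset.Icc (-k) k, R i = 0) (hneg : R 0 + R k + R (-k) < 0) :
    ∃ η j, 0 ≤ ((minusFamily k η j).map (wt R)).sum := by
  have hkQ : (3 : ℚ) ≤ k := by exact_mod_cast hk
  rcases le_or_gt (R k + R (-k)) 0 with hρ | hρ
  · refine ⟨false, 1, ?_⟩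
    rw [minusFamily_weight hk (by omega) hR]
    simp only [Finset.Icc_eq_empty_of_lt (show (1 : ℤ) < 2 by norm_num), Finset.sum_empty]
    norm_num
    nlinarith
  rcases hk.eq_or_lt with rfl | hk'
  · have hR' := hR
    rw [sum_Icc_of_lt (by norm_num), sum_Ioo_fold (by norm_num),
      show Finset.Ioo (0 : ℤ) 3 = {1, 2} by rfl, Finset.sum_pair (by norm_num)] at hR
    rcases le_total (R 1 + R (-1)) 0 with h1 | h1
    · refine ⟨false, 2, ?_⟩
      rw [minusFamily_weight le_rfl (by norm_num) hR', Finset.Icc_self, Finset.sum_singleton]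
      norm_num
      linarith
    · refine ⟨true, 2, ?_⟩
      rw [minusFamily_weight le_rfl (by norm_num) hR', Finset.Icc_self, Finset.sum_singleton]
      norm_num
      linarith
  · refine ⟨false, k - 2, ?_⟩
    have hkQ : (4 : ℚ) ≤ k := by exact_mod_cast hk'
    have hcard : (((Finset.Icc 2 (k - 2)).card : ℤ) : ℚ) = k - 3 := by
      rw [Int.card_Icc, Int.toNat_of_nonneg (by omega)]
      push_cast
      ring
    rw [minusFamily_weight hk (by omega) hR]
    rw [Finset.sum_congr rfl (g := fun d => (R k + R (-k) - 2 * R 0) +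
        ((R d + R (-d)) - (R (k - d) + R (-(k - d))))) fun d _ => by ring,
      Finset.sum_add_distrib, sum_Icc_two_reflect k fun d => R d + R (-d), Finset.sum_const,
      nsmul_eq_mul]
    push_cast at hcard
    rw [hcard]
    norm_num
    nlinarith [mul_nonneg (sub_nonneg.2 hkQ) hρ.le, mul_pos_of_neg_of_neg hneg
      (show 9 - 4 * (k : ℚ) < 0 by linarith)]

lemma sum_centered (k : ℕ) (r : ℕ → ℚ) :
    ∑ i ∈ Finset.Icc (-(k : ℤ)) k, r (i + k).toNat = ∑ i ∈ Finset.range (2 * k + 1), r i := by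
  apply Finset.sum_nbij' (fun i : ℤ => (i + k).toNat) (fun i : ℕ => (i : ℤ) - k) <;>
    simp only [Finset.mem_Icc, Finset.mem_range] <;> intros <;> first | omega | simp

/-- Hilbert–Mumford semi-stability of the 1st syzygy point of the balanced ribbon with
respect to the maximal torus acting diagonally on `x_0, …, x_{2k}`: for every rational
character `r` with `Σ r_i = 0` there is a monomial basis of cosyzygies of non-negative
`r`-state. -/
theorem stmt_18 (k : ℕ) (hk : 2 ≤ k) (r : ℕ → ℚ)
    (hr : ∑ i ∈ Finset.range (2 * k + 1), r i = 0) :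
    ∃ S : Finset (ℕ × ℕ × ℕ),
      (∀ t ∈ S, t.1 ≤ 2 * k ∧ t.2.1 ≤ 2 * k ∧ t.2.2 ≤ 2 * k ∧ t.1 ≠ t.2.1) ∧
      IsMonomialBasisOfCosyzygies k S ∧
      0 ≤ ∑ t ∈ S, (r t.1 + r t.2.1 + r t.2.2) := by
  have hk' : (2 : ℤ) ≤ k := by omega
  set R : ℤ → ℚ := fun i => r (i + k).toNat with hRdef
  have hR : ∑ i ∈ Finset.Icc (-(k : ℤ)) k, R i = 0 := (sum_centered k r).trans hr
  by_cases h : 0 ≤ R 0 + R k + R (-k) ∨ k = 2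
  · refine exists_basis k (by omega) (plusFamily k) (plusFamily_valid hk') (plusFamily_card hk')
      (plusFamily_central.rigid hk') r ?_
    rw [← hRdef, plusFamily_weight hk' R hR]
    rcases h with h | rfl
    · have hkQ : (2 : ℚ) ≤ k := by exact_mod_cast hk
      push_cast
      exact mul_nonneg (by nlinarith) h
    · norm_num
  · rw [not_or, not_le] at h
    have hk3 : (3 : ℤ) ≤ k := by omega
    obtain ⟨η, j, hw⟩ := exists_minusFamily_weight_nonneg hk3 hR h.1
    exact exists_basis k (by omega) (minusFamily k η j) (minusFamily_valid hk3)
      (minusFamily_card hk3) (minusFamily_rigid hk3) r hw
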